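/- arXiv:1604.05201 — 3 statements merged into one kernel-verified Lean document; each statement's English description precedes it below -/
import Mathlib

section
/- For every ε ∈ (0,1] the boundary value problem −ε²u″(x) + f(x,u(x)) = 0 for x ∈ (0,1), u(0) = u(1) = 0, has exactly one solution u, and this solution is four times continuously differentiable on [0,1]. -/
open Set Real

noncomputable section

/-- first partial derivative of `f(x,u)` with respect to `u` -/
def pderiv1 (f : ℝ → ℝ → ℝ) (x y : ℝ) : ℝ := deriv (fun z => f x z) y

/-- second partial derivative of `f(x,u)` with respect to `u` -/
def pderiv2 (f : ℝ → ℝ → ℝ) (x y : ℝ) : ℝ :=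
  deriv (fun z => deriv (fun w => f x w) z) y

/-- `f` is four times continuously differentiable on `[0,1] × ℝ`. -/
def SmoothF (f : ℝ → ℝ → ℝ) : Prop :=
  ContDiffOn ℝ 4 (fun p : ℝ × ℝ => f p.1 p.2) ((Icc (0:ℝ) 1) ×ˢ (univ : Set ℝ))

/-- the stability condition `f_u(x,u) ≥ c₀² > 0` on `[0,1] × ℝ` -/
def LowerF (f : ℝ → ℝ → ℝ) (c₀ : ℝ) : Prop :=
  ∀ x ∈ Icc (0:ℝ) 1, ∀ y : ℝ, c₀ ^ 2 ≤ pderiv1 f x y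

/-- `u` is a C⁴-solution of the semilinear BVP `-ε²u'' + f(x,u) = 0`, `u(0)=u(1)=0`. -/
def IsSolution (f : ℝ → ℝ → ℝ) (ε : ℝ) (u : ℝ → ℝ) : Prop :=
  ContDiffOn ℝ 4 u (Icc (0:ℝ) 1) ∧
  (∀ x ∈ Ioo (0:ℝ) 1,
    -ε ^ 2 * iteratedDerivWithin 2 u (Icc (0:ℝ) 1) x + f x (u x) = 0) ∧
  u 0 = 0 ∧ u 1 = 0

/-- the constant `l = c₀⁻² · max_{[0,1]} |f(x,0)|` -/
def lconst (f : ℝ → ℝ → ℝ) (c₀ : ℝ) : ℝ :=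
  c₀ ^ (-2 : ℤ) * sSup ((fun x => |f x 0|) '' Icc (0:ℝ) 1)

/-- the constant `θ = max { |f_uu(x,ξ)| : x ∈ [0,1], |ξ| ≤ l + 2ρ }` -/
def thconst (f : ℝ → ℝ → ℝ) (c₀ ρ : ℝ) : ℝ :=
  sSup ((fun p : ℝ × ℝ => |pderiv2 f p.1 p.2|) ''
    ((Icc (0:ℝ) 1) ×ˢ (Icc (-(lconst f c₀ + 2*ρ)) (lconst f c₀ + 2*ρ))))

/-- discrete second difference `y_{x̄x̂,i}` on a nonuniform mesh `x` (for `1 ≤ i`),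
using `ℏ_i = (h_i + h_{i+1})/2 = (x_{i+1} - x_{i-1})/2`. -/
def ddiff (x y : ℕ → ℝ) (i : ℕ) : ℝ :=
  2 / (x (i+1) - x (i-1)) *
    ((y (i+1) - y i) / (x (i+1) - x i) - (y i - y (i-1)) / (x i - x (i-1)))

/-- Shishkin mesh generating function with transition parameter
`α = min(1/4, 2γ₀⁻¹ ε ln n)`. -/
def shishkinLam (γ₀ ε : ℝ) (n : ℕ) (t : ℝ) : ℝ :=
  let α := min (1/4) (2 * γ₀⁻¹ * ε * Real.log n)
  if t ≤ 1/4 then 4*α*t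
  else if t ≤ 1/2 then α + 2*(1-2*α)*(t-1/4)
  else 1 - (if 1-t ≤ 1/4 then 4*α*(1-t) else α + 2*(1-2*α)*((1-t)-1/4))

/-- Shishkin mesh nodes `x_i = λ(i/n)` -/
def shishkinMesh (γ₀ ε : ℝ) (n i : ℕ) : ℝ := shishkinLam γ₀ ε n ((i:ℝ)/(n:ℝ))

def bakhPhi (a ε q t : ℝ) : ℝ := a*ε*Real.log (q/(q-t))

/-- derivative of `bakhPhi` -/
def bakhPhi' (a ε q t : ℝ) : ℝ := a*ε/(q-t)

/-- `α ∈ (0,q)` is the abscissa of the contact point of the tangent line from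
`(1/2,1/2)` to `φ`, i.e. `φ(α) + φ'(α)(1/2 - α) = 1/2`. -/
def IsBakhAlpha (a ε q α : ℝ) : Prop :=
  α ∈ Ioo 0 q ∧ bakhPhi a ε q α + bakhPhi' a ε q α * (1/2 - α) = 1/2

/-- Bakhvalov mesh generating function -/
def bakhLam (a ε q α t : ℝ) : ℝ :=
  if t ≤ α then bakhPhi a ε q t
  else if t ≤ 1/2 then bakhPhi a ε q α + bakhPhi' a ε q α * (t-α)
  else 1 - (if 1-t ≤ α then bakhPhi a ε q (1-t)
            else bakhPhi a ε q α + bakhPhi' a ε q α * ((1-t)-α))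

/-- Bakhvalov mesh nodes `x_i = λ(i/n)` -/
def bakhMesh (a ε q α : ℝ) (n i : ℕ) : ℝ := bakhLam a ε q α ((i:ℝ)/(n:ℝ))

def vulAlpha (a ε q : ℝ) : ℝ :=
  (q - Real.sqrt (ε*a*q*(1-2*q+2*ε*a)))/(1+2*ε*a)

def vulMu (a ε q t : ℝ) : ℝ := a*ε*t/(q-t)

/-- derivative of `vulMu` -/
def vulMu' (a ε q t : ℝ) : ℝ := a*ε*q/(q-t)^2

/-- Vulanović mesh generating function -/
def vulLam (a ε q t : ℝ) : ℝ :=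
  let α := vulAlpha a ε q
  if t ≤ α then vulMu a ε q t
  else if t ≤ 1/2 then vulMu a ε q α + vulMu' a ε q α * (t-α)
  else 1 - (if 1-t ≤ α then vulMu a ε q (1-t)
            else vulMu a ε q α + vulMu' a ε q α * ((1-t)-α))

/-- Vulanović mesh nodes `x_i = λ(i/n)` -/
def vulMesh (a ε q : ℝ) (n i : ℕ) : ℝ := vulLam a ε q ((i:ℝ)/(n:ℝ))

/-- the three-point discrete scheme for the linear problem
`-ε² y_{x̄x̂,i} + b(x_i) y_i = g(x_i)`, `y_0 = y_n = 0` -/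
def LinScheme (bc gc : ℝ → ℝ) (ε : ℝ) (x : ℕ → ℝ) (n : ℕ) (y : ℕ → ℝ) : Prop :=
  (∀ i : ℕ, 1 ≤ i → i < n →
    -ε ^ 2 * ddiff x y i + bc (x i) * y i = gc (x i)) ∧
  y 0 = 0 ∧ y n = 0

/-- the nonlinear discrete scheme `-ε² y_{x̄x̂,i} + f(x_i, y_i) = 0`, `y_0 = y_n = 0` -/
def NonlinScheme (f : ℝ → ℝ → ℝ) (ε : ℝ) (x : ℕ → ℝ) (n : ℕ) (y : ℕ → ℝ) : Prop :=
  (∀ i : ℕ, 1 ≤ i → i < n → -ε ^ 2 * ddiff x y i + f (x i) (y i) = 0) ∧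
  y 0 = 0 ∧ y n = 0

/-- `u` is a C²-solution of the continuous linear problem
`-ε²u'' + b(x)u = g(x)`, `u(0)=u(1)=0`. -/
def IsLinSolution (bc gc : ℝ → ℝ) (ε : ℝ) (u : ℝ → ℝ) : Prop :=
  ContDiffOn ℝ 2 u (Icc (0:ℝ) 1) ∧
  (∀ x ∈ Ioo (0:ℝ) 1,
    -ε ^ 2 * iteratedDerivWithin 2 u (Icc (0:ℝ) 1) x + bc x * u x = gc x) ∧
  u 0 = 0 ∧ u 1 = 0

/-- `b(x,ε)` is three times continuously differentiable in `x` on `[0,1]`,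
with these derivatives bounded uniformly in `ε ∈ [0,1]`. -/
def UnifC3 (b : ℝ → ℝ → ℝ) : Prop :=
  ∃ M : ℝ, ∀ ε ∈ Icc (0:ℝ) 1,
    ContDiffOn ℝ 3 (fun x => b x ε) (Icc (0:ℝ) 1) ∧
    ∀ j : ℕ, j ≤ 3 → ∀ x ∈ Icc (0:ℝ) 1,
      |iteratedDerivWithin j (fun x => b x ε) (Icc (0:ℝ) 1) x| ≤ M

/-- `w` is the continuous piecewise-linear interpolant of mesh data `y`
on the mesh `x_0 < … < x_n`. -/
def IsLinInterp (x : ℕ → ℝ) (n : ℕ) (y : ℕ → ℝ) (w : ℝ → ℝ) : Prop :=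
  (∀ i ≤ n, w (x i) = y i) ∧
  ∀ i < n, ∀ t ∈ Icc (x i) (x (i+1)),
    w t = y i + (y (i+1) - y i) * (t - x i) / (x (i+1) - x i)

/-- properties of the initial guess `u⁰`: of class C³, within `ρ` of the
solution `u`, and satisfying ε-uniform bounds of layer type for `j = 0, 1`. -/
def InitGuess (c₀ ε C₀ ρ : ℝ) (u u0 : ℝ → ℝ) : Prop :=
  ContDiffOn ℝ 3 u0 (Icc (0:ℝ) 1) ∧
  (∀ x ∈ Icc (0:ℝ) 1, |u0 x - u x| ≤ ρ) ∧
  (∀ x ∈ Icc (0:ℝ) 1, |u0 x| ≤ C₀) ∧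
  (∀ x ∈ Icc (0:ℝ) 1, |derivWithin u0 (Icc (0:ℝ) 1) x| ≤
    C₀ * (1 + ε⁻¹ * (Real.exp (-c₀*x/ε) + Real.exp (-c₀*(1-x)/ε))))

/-- the discrete Newton (quasilinearization) iterates on the mesh `x`:
`y⁰_i = u⁰(x_i)` and `y^{m+1}` solves the quasilinearized discrete problem. -/
def NewtonIter (f : ℝ → ℝ → ℝ) (ε : ℝ) (x : ℕ → ℝ) (n : ℕ) (u0 : ℝ → ℝ)
    (Y : ℕ → ℕ → ℝ) : Prop :=
  (∀ i ≤ n, Y 0 i = u0 (x i)) ∧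
  ∀ m : ℕ,
    (∀ i : ℕ, 1 ≤ i → i < n →
      -ε ^ 2 * ddiff x (Y (m+1)) i + pderiv1 f (x i) (Y m i) * Y (m+1) i
        = -f (x i) (Y m i) + pderiv1 f (x i) (Y m i) * Y m i) ∧
    Y (m+1) 0 = 0 ∧ Y (m+1) n = 0

/-- maximum principle -/
theorem aux_max_principle (w : ℝ → ℝ) (M : ℝ) (hc : ContinuousOn w (Icc (0:ℝ) 1))
    (h0 : w 0 ≤ M) (h1 : w 1 ≤ M)
    (h2 : ∀ x ∈ Ioo (0:ℝ) 1, M < w x → 0 < deriv (deriv w) x) :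
    ∀ x ∈ Icc (0:ℝ) 1, w x ≤ M := by
  intro y hy
  by_contra! hlt
  obtain ⟨x, hx, hmax⟩ := isCompact_Icc.exists_isMaxOn ⟨y, hy⟩ hc
  have hMx : M < w x := lt_of_lt_of_le hlt (hmax hy)
  have hx0 : x ≠ 0 := by rintro rfl; linarith
  have hx1 : x ≠ 1 := by rintro rfl; linarith
  have hxo : x ∈ Ioo (0:ℝ) 1 :=
    ⟨lt_of_le_of_ne hx.1 (Ne.symm hx0), lt_of_le_of_ne hx.2 hx1⟩
  have hnh : Icc (0:ℝ) 1 ∈ nhds x := Icc_mem_nhds hxo.1 hxo.2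
  have hlm : IsLocalMax w x := hmax.isLocalMax hnh
  have hd := h2 x hxo hMx
  have hmin := isLocalMin_of_deriv_deriv_pos hd hlm.deriv_eq_zero (hc.continuousAt hnh)
  have heq : w =ᶠ[nhds x] fun _ => w x := by
    filter_upwards [hlm, hmin] with z hz1 hz2
    exact le_antisymm hz1 hz2
  have := heq.deriv.deriv_eq
  simp at this
  linarith

theorem aux_iter (v : ℝ → ℝ) (x : ℝ) (hx : x ∈ Ioo (0:ℝ) 1) :
    iteratedDerivWithin 2 v (Icc (0:ℝ) 1) x = deriv (deriv v) x := by
  have hnh : Icc (0:ℝ) 1 ∈ nhds x := Icc_mem_nhds hx.1 hx.2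
  have h : iteratedFDerivWithin ℝ 2 v (Icc (0:ℝ) 1) x = iteratedFDerivWithin ℝ 2 v univ x :=
    iteratedFDerivWithin_congr_set (Filter.eventuallyEq_univ.2 hnh) 2
  have : iteratedDerivWithin 2 v (Icc (0:ℝ) 1) x = iteratedDeriv 2 v x := by
    rw [iteratedDerivWithin, h, iteratedFDerivWithin_univ, iteratedDeriv]
  rw [this, iteratedDeriv_eq_iterate]
  rfl

/-- the linear problem -/
theorem aux_linear (k : ℝ) (hk : 0 < k) (h : ℝ → ℝ) (hh : Continuous h) :
    ∃ w w1 : ℝ → ℝ, w 0 = 0 ∧ w 1 = 0 ∧ (∀ x, HasDerivAt w (w1 x) x) ∧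
      (∀ x, HasDerivAt w1 (k ^ 2 * w x - h x) x) := by
  set A : ℝ → ℝ := fun x => ∫ t in (0:ℝ)..x, Real.exp (-(k * t)) * h t with hA
  set B : ℝ → ℝ := fun x => ∫ t in (0:ℝ)..x, Real.exp (k * t) * h t with hB
  have dA : ∀ x, HasDerivAt A (Real.exp (-(k * x)) * h x) x := fun x =>
    (Continuous.integral_hasStrictDerivAt (f := fun t => Real.exp (-(k * t)) * h t)
      (by fun_prop) 0 x).hasDerivAt
  have dB : ∀ x, HasDerivAt B (Real.exp (k * x) * h x) x := fun x =>
    (Continuous.integral_hasStrictDerivAt (f := fun t => Real.exp (k * t) * h t)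
      (by fun_prop) 0 x).hasDerivAt
  have hA0 : A 0 = 0 := by simp [hA]
  have hB0 : B 0 = 0 := by simp [hB]
  have dk : ∀ x, HasDerivAt (fun x : ℝ => k * x) k x := fun x => by
    simpa using (hasDerivAt_id x).const_mul k
  have dE : ∀ x, HasDerivAt (fun x : ℝ => Real.exp (k * x)) (Real.exp (k * x) * k) x :=
    fun x => (dk x).exp
  have dN : ∀ x, HasDerivAt (fun x : ℝ => Real.exp (-(k * x))) (Real.exp (-(k * x)) * (-k)) x :=
    fun x => (dk x).neg.exp
  have hEN : ∀ x, Real.exp (k * x) * Real.exp (-(k * x)) = 1 := fun x => by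
    rw [← Real.exp_add]; simp
  obtain ⟨s, hs⟩ : ∃ s : ℝ, s * (Real.exp (k * 1) - Real.exp (-(k * 1))) =
      (1 / (2 * k)) * (Real.exp (k * 1) * A 1 - Real.exp (-(k * 1)) * B 1) := by
    have : 0 < Real.exp (k * 1) - Real.exp (-(k * 1)) := by
      rw [sub_pos, Real.exp_lt_exp]; linarith
    exact ⟨_, div_mul_cancel₀ _ this.ne'⟩
  refine ⟨fun x => s * (Real.exp (k * x) - Real.exp (-(k * x))) -
      (1 / (2 * k)) * (Real.exp (k * x) * A x - Real.exp (-(k * x)) * B x),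
    fun x => s * k * (Real.exp (k * x) + Real.exp (-(k * x))) -
      (1 / 2) * (Real.exp (k * x) * A x + Real.exp (-(k * x)) * B x), ?_, ?_, ?_, ?_⟩
  · simp [hA0, hB0]
  · simp only [hs, sub_self]
  · intro x
    have := (((dE x).sub (dN x)).const_mul s).sub
      ((((dE x).mul (dA x)).sub ((dN x).mul (dB x))).const_mul (1 / (2 * k)))
    refine this.congr_deriv ?_
    have e := hEN x
    field_simp
    ring
  · intro x
    have := (((dE x).add (dN x)).const_mul (s * k)).sub
      ((((dE x).mul (dA x)).add ((dN x).mul (dB x))).const_mul (1 / 2))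
    refine this.congr_deriv ?_
    have e := hEN x
    field_simp
    linear_combination (-2 * h x) * e

/-- fixed point -/
theorem aux_fixed (g : ℝ → ℝ → ℝ) (K c L ε : ℝ) (hc : 0 < c) (hcK : c < K) (hε : 0 < ε)
    (hg : Continuous fun p : Icc (0:ℝ) 1 × ℝ => g p.1 p.2)
    (hlip : ∀ x ∈ Icc (0:ℝ) 1, ∀ a b, |g x a - g x b| ≤ (K - c) * |a - b|)
    (hbd : ∀ x ∈ Icc (0:ℝ) 1, ∀ a, |g x a| ≤ K * L) (hL : 0 ≤ L) :
    ∃ w w1 h : ℝ → ℝ, w 0 = 0 ∧ w 1 = 0 ∧ (∀ x, HasDerivAt w (w1 x) x) ∧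
      (∀ x, HasDerivAt w1 (h x) x) ∧
      (∀ x ∈ Icc (0:ℝ) 1, h x = (K * w x - g x (w x)) / ε ^ 2) ∧
      (∀ x ∈ Icc (0:ℝ) 1, |w x| ≤ L) := by
  have hK : 0 < K := hc.trans hcK
  have hε2 : 0 < ε ^ 2 := by positivity
  set k := Real.sqrt K / ε with hkdef
  have hk : 0 < k := by positivity
  have hk2 : k ^ 2 = K / ε ^ 2 := by rw [hkdef, div_pow, Real.sq_sqrt hK.le]
  let pr : ℝ → Icc (0:ℝ) 1 := projIcc 0 1 zero_le_one
  have hpr : Continuous pr := continuous_projIcc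
  have hprx : ∀ x (hx : x ∈ Icc (0:ℝ) 1), pr x = ⟨x, hx⟩ := fun x hx => projIcc_of_mem _ hx
  let H : C(Icc (0:ℝ) 1, ℝ) → ℝ → ℝ := fun u x => g (pr x) (u (pr x)) / ε ^ 2
  have hH : ∀ u, Continuous (H u) := fun u => by
    have : Continuous fun x => g (pr x) (u (pr x)) :=
      hg.comp (hpr.prodMk (u.continuous.comp hpr))
    exact this.div_const _
  choose W W1 hW0 hW1 hdW hdW1 using fun u => aux_linear k hk (H u) (hH u)
  have hWc : ∀ u, Continuous (W u) := fun u =>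
    continuous_iff_continuousAt.2 fun x => (hdW u x).continuousAt
  have ddW : ∀ u, deriv (W u) = W1 u := fun u => funext fun x => (hdW u x).deriv
  let T : C(Icc (0:ℝ) 1, ℝ) → C(Icc (0:ℝ) 1, ℝ) := fun u =>
    ⟨fun x => W u x, (hWc u).comp continuous_subtype_val⟩
  have hHlip : ∀ u v x, |H u x - H v x| ≤ (K - c) * dist u v / ε ^ 2 := by
    intro u v x
    simp only [H]
    rw [← sub_div, abs_div, abs_of_pos hε2]
    gcongr
    refine (hlip _ (pr x).2 _ _).trans ?_
    have h1 : 0 ≤ K - c := by linarith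
    have h2 := ContinuousMap.dist_apply_le_dist (f := u) (g := v) (pr x)
    rw [Real.dist_eq] at h2
    gcongr
  have key : ∀ u v, ∀ x ∈ Icc (0:ℝ) 1, W u x - W v x ≤ (K - c) / K * dist u v := by
    intro u v
    have hM : 0 ≤ (K - c) / K * dist u v :=
      mul_nonneg (div_nonneg (by linarith) hK.le) dist_nonneg
    refine aux_max_principle (fun x => W u x - W v x) _
      ((hWc u).sub (hWc v)).continuousOn (by simpa [hW0] using hM) (by simpa [hW1] using hM) ?_
    intro x hx hlt
    have e1 : deriv (fun x => W u x - W v x) = fun x => W1 u x - W1 v x :=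
      funext fun x => ((hdW u x).sub (hdW v x)).deriv
    rw [e1, ((hdW1 u x).fun_sub (hdW1 v x)).deriv]
    have h3 := le_of_abs_le (hHlip u v x)
    have h4 : k ^ 2 * ((K - c) / K * dist u v) = (K - c) * dist u v / ε ^ 2 := by
      rw [hk2]; field_simp
    have h5 := mul_lt_mul_of_pos_left hlt (pow_pos hk 2)
    linarith
  have hq : 0 ≤ (K - c) / K := div_nonneg (by linarith) hK.le
  have hq1 : (K - c) / K < 1 := by rw [div_lt_one hK]; linarith
  have hT : ContractingWith ⟨(K - c) / K, hq⟩ T := by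
    refine ⟨by exact_mod_cast hq1, LipschitzWith.of_dist_le_mul fun u v => ?_⟩
    rw [ContinuousMap.dist_le (by positivity)]
    intro x
    rw [Real.dist_eq]
    refine abs_le.2 ⟨?_, key u v x x.2⟩
    have := key v u x x.2
    rw [dist_comm] at this
    change -((K - c) / K * dist u v) ≤ W u x - W v x
    linarith
  set u := hT.fixedPoint T
  have hu : T u = u := hT.fixedPoint_isFixedPt
  have huW : ∀ x (hx : x ∈ Icc (0:ℝ) 1), u ⟨x, hx⟩ = W u x := fun x hx => by
    conv_lhs => rw [← hu]
    rfl
  have hHb : ∀ x, |H u x| ≤ k ^ 2 * L := fun x => by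
    simp only [H]
    rw [abs_div, abs_of_pos hε2, hk2, div_mul_eq_mul_div]
    gcongr
    exact hbd _ (pr x).2 _
  refine ⟨W u, W1 u, _, hW0 u, hW1 u, hdW u, hdW1 u, ?_, ?_⟩
  · intro x hx
    simp only [H]
    rw [hprx x hx, huW x hx, hk2]
    ring
  · intro x hx
    rw [abs_le]
    constructor
    · have := aux_max_principle (fun x => - W u x) L (hWc u).neg.continuousOn
        (by simpa [hW0] using hL) (by simpa [hW1] using hL) (by
          intro x hx hlt
          have e1 : deriv (fun x => - W u x) = fun x => - W1 u x :=
            funext fun x => (hdW u x).neg.deriv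
          rw [e1, (hdW1 u x).fun_neg.deriv]
          have h5 := mul_lt_mul_of_pos_left hlt (pow_pos hk 2)
          have := (abs_le.1 (hHb x)).1
          linarith) x hx
      linarith
    · exact aux_max_principle (W u) L (hWc u).continuousOn
        (by simpa [hW0] using hL) (by simpa [hW1] using hL) (by
          intro x hx hlt
          rw [ddW, (hdW1 u x).deriv]
          have h5 := mul_lt_mul_of_pos_left hlt (pow_pos hk 2)
          have := (abs_le.1 (hHb x)).2
          linarith) x hx

theorem aux_cd (n : ℕ) (w w1 : ℝ → ℝ) (hd : ∀ x, HasDerivAt w (w1 x) x)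
    (h : ContDiffOn ℝ n w1 (Icc (0:ℝ) 1)) : ContDiffOn ℝ (n + 1) w (Icc (0:ℝ) 1) := by
  have hU : UniqueDiffOn ℝ (Icc (0:ℝ) 1) := uniqueDiffOn_Icc_zero_one
  rw [contDiffOn_succ_iff_derivWithin hU]
  refine ⟨fun x _ => (hd x).differentiableAt.differentiableWithinAt, by simp, ?_⟩
  exact h.congr fun x hx => (hd x).hasDerivWithinAt.derivWithin (hU x hx)

/-- lower slope bound -/
theorem aux_slope (f : ℝ → ℝ → ℝ) (c₀ : ℝ) (hc₀ : 0 < c₀) (hfu : LowerF f c₀)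
    (x : ℝ) (hx : x ∈ Icc (0:ℝ) 1) (a b : ℝ) (hab : a ≤ b) :
    c₀ ^ 2 * (b - a) ≤ f x b - f x a := by
  refine mul_sub_le_image_sub_of_le_deriv (f := fun z => f x z) ?_ (hfu x hx) hab
  intro y
  apply differentiableAt_of_deriv_ne_zero
  have := hfu x hx y
  have h2 : 0 < c₀ ^ 2 := by positivity
  unfold pderiv1 at this
  linarith

/-- comparison of two `C²` solutions -/
theorem aux_unique (f : ℝ → ℝ → ℝ) (c₀ : ℝ) (hc₀ : 0 < c₀) (hfu : LowerF f c₀)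
    (ε : ℝ) (hε : 0 < ε) (u v : ℝ → ℝ)
    (hu : ContDiffOn ℝ 2 u (Icc (0:ℝ) 1)) (hv : ContDiffOn ℝ 2 v (Icc (0:ℝ) 1))
    (eu : ∀ x ∈ Ioo (0:ℝ) 1,
      -ε ^ 2 * iteratedDerivWithin 2 u (Icc (0:ℝ) 1) x + f x (u x) = 0)
    (ev : ∀ x ∈ Ioo (0:ℝ) 1,
      -ε ^ 2 * iteratedDerivWithin 2 v (Icc (0:ℝ) 1) x + f x (v x) = 0)
    (u0 : u 0 = 0) (u1 : u 1 = 0) (v0 : v 0 = 0) (v1 : v 1 = 0) :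
    ∀ x ∈ Icc (0:ℝ) 1, u x - v x ≤ 0 := by
  refine aux_max_principle (fun x => u x - v x) 0 (hu.continuousOn.sub hv.continuousOn)
    (by simp [u0, v0]) (by simp [u1, v1]) ?_
  intro x hx hlt
  have hreg : ∀ z : ℝ → ℝ, ContDiffOn ℝ 2 z (Icc (0:ℝ) 1) →
      (∀ y ∈ Ioo (0:ℝ) 1, DifferentiableAt ℝ z y) ∧ DifferentiableAt ℝ (deriv z) x := by
    intro z hz
    have hz' : ContDiffOn ℝ (1 + 1) z (Ioo (0:ℝ) 1) := by
      rw [one_add_one_eq_two]; exact hz.mono Ioo_subset_Icc_self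
    rw [contDiffOn_succ_iff_deriv_of_isOpen isOpen_Ioo] at hz'
    exact ⟨fun y hy => hz'.1.differentiableAt (isOpen_Ioo.mem_nhds hy),
      (hz'.2.2.differentiableOn one_ne_zero).differentiableAt (isOpen_Ioo.mem_nhds hx)⟩
  obtain ⟨hu1, hu2⟩ := hreg u hu
  obtain ⟨hv1, hv2⟩ := hreg v hv
  have e : deriv (fun x => u x - v x) =ᶠ[nhds x] fun x => deriv u x - deriv v x := by
    filter_upwards [isOpen_Ioo.mem_nhds hx] with y hy
    exact ((hu1 y hy).hasDerivAt.sub (hv1 y hy).hasDerivAt).deriv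
  rw [e.deriv_eq, (hu2.hasDerivAt.fun_sub hv2.hasDerivAt).deriv]
  have h1 := eu x hx
  have h2 := ev x hx
  rw [aux_iter _ _ hx] at h1 h2
  have hlt' : 0 < u x - v x := hlt
  have h3 := aux_slope f c₀ hc₀ hfu x (Ioo_subset_Icc_self hx) (v x) (u x) (by linarith)
  have h4 : 0 < c₀ ^ 2 * (u x - v x) := by positivity
  have h5 : 0 < ε ^ 2 * (deriv (deriv u) x - deriv (deriv v) x) := by linarith
  exact pos_of_mul_pos_right h5 (by positivity)

theorem aux_clamp (L a b : ℝ) (hL : 0 ≤ L) (hab : a ≤ b) :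
    max (-L) (min b L) - max (-L) (min a L) ≤ b - a := by
  grind

/-- for every `ε ∈ (0,1]` the BVP `-ε²u'' + f(x,u) = 0`,
`u(0) = u(1) = 0` has exactly one solution, and it is of class C⁴ on `[0,1]`. -/
theorem stmt_0 (f : ℝ → ℝ → ℝ) (c₀ : ℝ) (hc₀ : 0 < c₀)
    (hf : SmoothF f) (hfu : LowerF f c₀)
    (ε : ℝ) (hε : ε ∈ Ioc (0:ℝ) 1) :
    ∃ u : ℝ → ℝ, IsSolution f ε u ∧
      ∀ v : ℝ → ℝ, ContDiffOn ℝ 2 v (Icc (0:ℝ) 1) →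
        (∀ x ∈ Ioo (0:ℝ) 1,
          -ε ^ 2 * iteratedDerivWithin 2 v (Icc (0:ℝ) 1) x + f x (v x) = 0) →
        v 0 = 0 → v 1 = 0 → EqOn v u (Icc (0:ℝ) 1) := by
  obtain ⟨hε0, hε1⟩ := hε
  have hc2 : 0 < c₀ ^ 2 := by positivity
  unfold SmoothF at hf
  have hε2 : 0 < ε ^ 2 := by positivity
  -- bound of f(x,0)
  have hf0 : ContinuousOn (fun x => f x 0) (Icc (0:ℝ) 1) :=
    hf.continuousOn.comp (f := fun x : ℝ => (x, (0:ℝ))) (by fun_prop)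
      (fun x hx => ⟨hx, mem_univ _⟩)
  obtain ⟨M, hM⟩ := isCompact_Icc.exists_bound_of_continuousOn hf0
  have hM0 : 0 ≤ M := (norm_nonneg _).trans (hM 0 (by simp))
  set L := M / c₀ ^ 2 with hLdef
  have hL : 0 ≤ L := by positivity
  have hcL : c₀ ^ 2 * L = M := by rw [hLdef]; field_simp
  -- Lipschitz constant
  obtain ⟨K₀, hK₀⟩ := (hf.mono (prod_mono_right (subset_univ (Icc (-L) L)))).exists_lipschitzOnWith
    (by norm_num) ((convex_Icc 0 1).prod (convex_Icc _ _)) (isCompact_Icc.prod isCompact_Icc)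
  set K : ℝ := max (K₀ : ℝ) (c₀ ^ 2 + 1) with hK
  have hcK : c₀ ^ 2 < K := lt_of_lt_of_le (by linarith) (le_max_right _ _)
  have hup : ∀ x ∈ Icc (0:ℝ) 1, ∀ a ∈ Icc (-L) L, ∀ b ∈ Icc (-L) L, a ≤ b →
      f x b - f x a ≤ K * (b - a) := by
    intro x hx a ha b hb hab
    have h := hK₀.dist_le_mul (x, b) ⟨hx, hb⟩ (x, a) ⟨hx, ha⟩
    rw [Real.dist_eq, Prod.dist_eq, dist_self, Real.dist_eq,
      abs_of_nonneg (sub_nonneg.2 hab), max_eq_right (sub_nonneg.2 hab)] at h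
    refine (le_abs_self _).trans (h.trans ?_)
    exact mul_le_mul_of_nonneg_right (le_max_left _ _) (sub_nonneg.2 hab)
  have hlow := aux_slope f c₀ hc₀ hfu
  let P : ℝ → ℝ := fun y => max (-L) (min y L)
  have hPm : ∀ y, P y ∈ Icc (-L) L := fun y =>
    ⟨le_max_left _ _, max_le (by linarith) (min_le_right _ _)⟩
  have hPc : Continuous P := by fun_prop
  have hPid : ∀ y, |y| ≤ L → P y = y := fun y hy => by
    have := abs_le.1 hy
    simp only [P]
    rw [min_eq_left this.2, max_eq_right this.1]
  have hPl : ∀ a b, a ≤ b → P a ≤ P b ∧ P b - P a ≤ b - a := by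
    intro a b hab
    exact ⟨max_le_max le_rfl (min_le_min hab le_rfl), aux_clamp L a b hL hab⟩
  have hfix := aux_fixed (fun x y => K * P y - f x (P y)) K (c₀ ^ 2) L ε hc2 hcK hε0 ?_ ?_ ?_ hL
  rotate_left
  · have h1 : Continuous fun p : Icc (0:ℝ) 1 × ℝ => f p.1 (P p.2) :=
      hf.continuousOn.comp_continuous (f := fun p : Icc (0:ℝ) 1 × ℝ => ((p.1 : ℝ), P p.2))
        (by fun_prop) (fun p => ⟨p.1.2, mem_univ _⟩)
    have h2 : Continuous fun p : Icc (0:ℝ) 1 × ℝ => K * P p.2 := by fun_prop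
    exact h2.sub h1
  · intro x hx
    have main : ∀ a b, a ≤ b → |(K * P b - f x (P b)) - (K * P a - f x (P a))|
        ≤ (K - c₀ ^ 2) * |b - a| := by
      intro a b hab
      obtain ⟨p1, p2⟩ := hPl a b hab
      have q1 := hlow x hx _ _ p1
      have q2 := hup x hx _ (hPm a) _ (hPm b) p1
      have q3 : (K - c₀ ^ 2) * (P b - P a) ≤ (K - c₀ ^ 2) * (b - a) :=
        mul_le_mul_of_nonneg_left p2 (by linarith)
      rw [abs_of_nonneg (sub_nonneg.2 hab), abs_of_nonneg (by linarith)]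
      linarith
    intro a b
    rcases le_total a b with hab | hab
    · rw [abs_sub_comm, abs_sub_comm a b]; exact main a b hab
    · exact main b a hab
  · intro x hx a
    have hp := hPm a
    have q1 := hup x hx _ hp L ⟨by linarith, le_rfl⟩ hp.2
    have q2 := hup x hx (-L) ⟨le_rfl, by linarith⟩ _ hp hp.1
    have q3 := hlow x hx 0 L hL
    have q4 := hlow x hx (-L) 0 (by linarith)
    have q5 := abs_le.1 (hM x hx)
    rw [abs_le]
    constructor <;> linarith [q5.1, q5.2]
  obtain ⟨w, w1, h, hw0, hw1, hdw, hdw1, hh, hwL⟩ := hfix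
  have hh' : ∀ x ∈ Icc (0:ℝ) 1, h x = f x (w x) / ε ^ 2 := by
    intro x hx
    rw [hh x hx, hPid _ (hwL x hx)]
    ring
  have boot : ∀ n : ℕ, n ≤ 4 → ContDiffOn ℝ n w (Icc (0:ℝ) 1) →
      ContDiffOn ℝ (n + 1 + 1 : ℕ) w (Icc (0:ℝ) 1) := by
    intro n hn hw
    have h1 : ContDiffOn ℝ n (fun x => f x (w x)) (Icc (0:ℝ) 1) :=
      (hf.of_le (by exact_mod_cast hn)).comp (f := fun x => (x, w x))
        (contDiffOn_id.prodMk hw) (fun x hx => ⟨hx, mem_univ _⟩)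
    have h2 : ContDiffOn ℝ n h (Icc (0:ℝ) 1) := (h1.div_const (ε ^ 2)).congr hh'
    have h3 := aux_cd n w1 h hdw1 h2
    exact_mod_cast aux_cd (n + 1) w w1 hdw (by exact_mod_cast h3)
  have hc0 : ContDiffOn ℝ (0 : ℕ) w (Icc (0:ℝ) 1) := by
    rw [Nat.cast_zero, contDiffOn_zero]
    exact fun x _ => (hdw x).continuousAt.continuousWithinAt
  have hw2 : ContDiffOn ℝ (2 : ℕ) w (Icc (0:ℝ) 1) := boot 0 (by norm_num) hc0
  have hw4 : ContDiffOn ℝ (4 : ℕ) w (Icc (0:ℝ) 1) := boot 2 (by norm_num) hw2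
  have heq : ∀ x ∈ Ioo (0:ℝ) 1,
      -ε ^ 2 * iteratedDerivWithin 2 w (Icc (0:ℝ) 1) x + f x (w x) = 0 := by
    intro x hx
    have e1 : deriv w = w1 := funext fun x => (hdw x).deriv
    rw [aux_iter _ _ hx, e1, (hdw1 x).deriv, hh' x (Ioo_subset_Icc_self hx)]
    field_simp
    ring
  refine ⟨w, ⟨hw4, heq, hw0, hw1⟩, ?_⟩
  intro v hv ev v0 v1 x hx
  have a1 := aux_unique f c₀ hc₀ hfu ε hε0 w v hw2 hv heq ev hw0 hw1 v0 v1 x hx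
  have a2 := aux_unique f c₀ hc₀ hfu ε hε0 v w hv hw2 ev heq v0 v1 hw0 hw1 x hx
  linarith
end
end

section
/- There exists a constant C > 0, independent of ε, such that for every ε ∈ (0,1] the solution u of the boundary value problem satisfies, for each j = 1, 2, 3 and every x ∈ [0,1], |u^{(j)}(x)| ≤ C(1 + ε^{−j}(exp(−c₀ x/ε) + exp(−c₀ (1−x)/ε))). -/
open Set Real

noncomputable section

/-- maximum principle -/
lemma aux_maxprin {ε : ℝ} (hε : 0 < ε) {v v1 v2 b : ℝ → ℝ}
    (h1 : ∀ x ∈ Icc (0:ℝ) 1, HasDerivWithinAt v (v1 x) (Icc (0:ℝ) 1) x)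
    (h2 : ∀ x ∈ Icc (0:ℝ) 1, HasDerivWithinAt v1 (v2 x) (Icc (0:ℝ) 1) x)
    (hb : ∀ x ∈ Ioo (0:ℝ) 1, 0 < b x)
    (hL : ∀ x ∈ Ioo (0:ℝ) 1, 0 ≤ -ε ^ 2 * v2 x + b x * v x)
    (h0 : 0 ≤ v 0) (h1' : 0 ≤ v 1) : ∀ x ∈ Icc (0:ℝ) 1, 0 ≤ v x := by
  have hcont : ContinuousOn v (Icc (0:ℝ) 1) := fun x hx => (h1 x hx).continuousWithinAt
  obtain ⟨z, hz, hmin⟩ := isCompact_Icc.exists_isMinOn (nonempty_Icc.2 zero_le_one) hcont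
  intro x hx
  by_contra hneg
  push Not at hneg
  have hzx : v z ≤ v x := hmin hx
  have hz0 : v z < 0 := lt_of_le_of_lt hzx hneg
  have hzI : z ∈ Ioo (0:ℝ) 1 := by
    refine ⟨lt_of_le_of_ne hz.1 ?_, lt_of_le_of_ne hz.2 ?_⟩
    · rintro rfl; linarith
    · rintro rfl; linarith
  have hnh : ∀ y ∈ Ioo (0:ℝ) 1, Icc (0:ℝ) 1 ∈ nhds y := fun y hy => Icc_mem_nhds hy.1 hy.2
  have d1 : ∀ y ∈ Ioo (0:ℝ) 1, HasDerivAt v (v1 y) y := fun y hy =>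
    (h1 y (Ioo_subset_Icc_self hy)).hasDerivAt (hnh y hy)
  have d2 : HasDerivAt v1 (v2 z) z := (h2 z hz).hasDerivAt (hnh z hzI)
  have hev : deriv v =ᶠ[nhds z] v1 := by
    filter_upwards [Ioo_mem_nhds hzI.1 hzI.2] with y hy using (d1 y hy).deriv
  have hdd : deriv (deriv v) z = v2 z := by rw [hev.deriv_eq, d2.deriv]
  have hlm : IsLocalMin v z := hmin.isLocalMin (hnh z hzI)
  have hd0 : deriv v z = 0 := hlm.deriv_eq_zero
  have hv2 : v2 z < 0 := by
    have := hL z hzI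
    have h3 := mul_neg_of_pos_of_neg (hb z hzI) hz0
    by_contra h4
    push Not at h4
    have : 0 ≤ ε ^ 2 * v2 z := by positivity
    linarith
  have hlM : IsLocalMax v z :=
    isLocalMax_of_deriv_deriv_neg (by rw [hdd]; exact hv2) hd0 (d1 z hzI).continuousAt
  have hconst : v =ᶠ[nhds z] fun _ => v z := by
    filter_upwards [hlm, hlM] with y hy hy' using le_antisymm hy' hy
  have h5 : deriv v =ᶠ[nhds z] deriv (fun _ => v z) := hconst.deriv
  have h6 : deriv (deriv v) z = 0 := by
    rw [h5.deriv_eq]; simp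
  rw [hdd] at h6
  linarith

/-- comparison principle -/
lemma aux_comp {ε : ℝ} (hε : 0 < ε) {v v1 v2 b B B1 B2 : ℝ → ℝ}
    (h1 : ∀ x ∈ Icc (0:ℝ) 1, HasDerivWithinAt v (v1 x) (Icc (0:ℝ) 1) x)
    (h2 : ∀ x ∈ Icc (0:ℝ) 1, HasDerivWithinAt v1 (v2 x) (Icc (0:ℝ) 1) x)
    (k1 : ∀ x ∈ Icc (0:ℝ) 1, HasDerivWithinAt B (B1 x) (Icc (0:ℝ) 1) x)
    (k2 : ∀ x ∈ Icc (0:ℝ) 1, HasDerivWithinAt B1 (B2 x) (Icc (0:ℝ) 1) x)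
    (hb : ∀ x ∈ Ioo (0:ℝ) 1, 0 < b x)
    (hL : ∀ x ∈ Ioo (0:ℝ) 1, |-ε ^ 2 * v2 x + b x * v x| ≤ -ε ^ 2 * B2 x + b x * B x)
    (h0 : |v 0| ≤ B 0) (h1' : |v 1| ≤ B 1) : ∀ x ∈ Icc (0:ℝ) 1, |v x| ≤ B x := by
  intro x hx
  rw [abs_le] at h0 h1'
  have p := aux_maxprin hε (v := fun x => B x - v x) (fun x hx => (k1 x hx).sub (h1 x hx))
    (fun x hx => (k2 x hx).sub (h2 x hx)) hb
    (fun x hx => by have := (abs_le.1 (hL x hx)).2; nlinarith) (by linarith) (by linarith) x hx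
  have m := aux_maxprin hε (v := fun x => B x + v x) (fun x hx => (k1 x hx).add (h1 x hx))
    (fun x hx => (k2 x hx).add (h2 x hx)) hb
    (fun x hx => by have := (abs_le.1 (hL x hx)).1; nlinarith) (by linarith) (by linarith) x hx
  rw [abs_le]
  constructor <;> linarith

/-- constant in the barrier estimate -/
def auxCb (c K : ℝ) : ℝ := K / c ^ 2 + (K + K / (3 * c ^ 2)) + K / (2 * c)

lemma aux_barrier0 {c ε K m k : ℝ} (hc : 0 < c) (hε : 0 < ε) (hK : 0 ≤ K) (hm : 0 ≤ m)
    {v v1 v2 b e0 e1 : ℝ → ℝ}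
    (hkε : k * ε = c)
    (de0 : ∀ x : ℝ, HasDerivAt e0 (-k * e0 x) x)
    (de1 : ∀ x : ℝ, HasDerivAt e1 (k * e1 x) x)
    (e0le : ∀ x ∈ Icc (0:ℝ) 1, e0 x ≤ 1) (e1le : ∀ x ∈ Icc (0:ℝ) 1, e1 x ≤ 1)
    (e00 : e0 0 = 1) (e11 : e1 1 = 1)
    (e0p : ∀ x : ℝ, 0 ≤ e0 x) (e1p : ∀ x : ℝ, 0 ≤ e1 x)
    (h1 : ∀ x ∈ Icc (0:ℝ) 1, HasDerivWithinAt v (v1 x) (Icc (0:ℝ) 1) x)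
    (h2 : ∀ x ∈ Icc (0:ℝ) 1, HasDerivWithinAt v1 (v2 x) (Icc (0:ℝ) 1) x)
    (hb : ∀ x ∈ Ioo (0:ℝ) 1, c ^ 2 ≤ b x)
    (hL : ∀ x ∈ Ioo (0:ℝ) 1, |-ε ^ 2 * v2 x + b x * v x| ≤
      K * (1 + m * ε * (e0 x + e1 x)
        + m * (e0 x ^ 2 + e1 x ^ 2)))
    (h0 : |v 0| ≤ K * m) (h1' : |v 1| ≤ K * m) :
    ∀ x ∈ Icc (0:ℝ) 1,
      |v x| ≤ auxCb c K * (1 + m * (e0 x + e1 x)) := by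
  obtain ⟨G, hG⟩ : ∃ G, G = K / (3 * c ^ 2) := ⟨_, rfl⟩
  obtain ⟨D, hD⟩ : ∃ D, D = K / (2 * c) := ⟨_, rfl⟩
  obtain ⟨C, hC⟩ : ∃ C, C = K / c ^ 2 := ⟨_, rfl⟩
  have hG0 : 0 ≤ G := by rw [hG]; positivity
  have hD0 : 0 ≤ D := by rw [hD]; positivity
  have hC0 : 0 ≤ C := by rw [hC]; positivity
  have hG1 : 3 * c ^ 2 * G = K := by rw [hG]; field_simp
  have hD1 : 2 * c * D = K := by rw [hD]; field_simp
  have hC1 : c ^ 2 * C = K := by rw [hC]; field_simp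
  have hCb : auxCb c K = C + (K + G) + D := by rw [hC, hD, hG]; rfl
  have B0 : ∀ x ∈ Icc (0:ℝ) 1, 0 ≤ C + m * ((K + G) * (e0 x + e1 x)
      + D * (x * e0 x + (1 - x) * e1 x) - G * (e0 x ^ 2 + e1 x ^ 2)) := by
    intro x hx
    have a0 : e0 x ^ 2 ≤ e0 x := by nlinarith [e0p x, e0le x hx]
    have a1 : e1 x ^ 2 ≤ e1 x := by nlinarith [e1p x, e1le x hx]
    have a2 : 0 ≤ G * (e0 x + e1 x - (e0 x ^ 2 + e1 x ^ 2)) := mul_nonneg hG0 (by linarith)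
    have a3 : 0 ≤ K * (e0 x + e1 x) := mul_nonneg hK (by linarith [e0p x, e1p x])
    have a4 : 0 ≤ D * (x * e0 x + (1 - x) * e1 x) := mul_nonneg hD0
      (add_nonneg (mul_nonneg hx.1 (e0p x)) (mul_nonneg (by linarith [hx.2]) (e1p x)))
    have a5 : 0 ≤ m * ((K + G) * (e0 x + e1 x)
      + D * (x * e0 x + (1 - x) * e1 x) - G * (e0 x ^ 2 + e1 x ^ 2)) :=
      mul_nonneg hm (by linarith)
    linarith
  have key := aux_comp hε (b := b) (B := fun x => C + m * ((K + G) * (e0 x + e1 x)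
      + D * (x * e0 x + (1 - x) * e1 x) - G * (e0 x ^ 2 + e1 x ^ 2)))
    (B1 := fun x => m * ((K + G) * (-k * e0 x + k * e1 x)
      + D * (e0 x - k * (x * e0 x) - e1 x + k * ((1 - x) * e1 x))
      - G * (-2 * k * e0 x ^ 2 + 2 * k * e1 x ^ 2)))
    (B2 := fun x => m * ((K + G) * (k ^ 2 * e0 x + k ^ 2 * e1 x)
      + D * (-2 * k * e0 x + k ^ 2 * (x * e0 x) - 2 * k * e1 x + k ^ 2 * ((1 - x) * e1 x))
      - G * (4 * k ^ 2 * e0 x ^ 2 + 4 * k ^ 2 * e1 x ^ 2))) h1 h2 ?_ ?_ ?_ ?_ ?_ ?_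
  · intro x hx
    refine (key x hx).trans ?_
    rw [hCb]
    have b0 := mul_nonneg hm (e0p x)
    have b1 := mul_nonneg hm (e1p x)
    have a2 : 0 ≤ m * (G * (e0 x ^ 2 + e1 x ^ 2)) := by positivity
    have a4 : 0 ≤ D * ((1 - x) * (m * e0 x) + x * (m * e1 x)) := mul_nonneg hD0
      (add_nonneg (mul_nonneg (by linarith [hx.2]) b0) (mul_nonneg hx.1 b1))
    have a5 : 0 ≤ C * (m * e0 x + m * e1 x) := mul_nonneg hC0 (by linarith)
    nlinarith
  · intro x hx
    have q0 := de0 x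
    have q1 := de1 x
    have i0 := hasDerivAt_id' x
    refine HasDerivAt.hasDerivWithinAt ?_
    refine ((((((q0.add q1).const_mul (K + G)).add (((i0.mul q0).add
      ((i0.const_sub 1).mul q1)).const_mul D)).sub
      (((q0.pow 2).add (q1.pow 2)).const_mul G)).const_mul m).const_add C).congr_deriv ?_
    push_cast
    ring
  · intro x hx
    have q0 := de0 x
    have q1 := de1 x
    have i0 := hasDerivAt_id' x
    refine HasDerivAt.hasDerivWithinAt ?_
    refine ((((((q0.const_mul (-k)).add (q1.const_mul k)).const_mul (K + G)).add
      ((((q0.sub ((i0.mul q0).const_mul k)).sub q1).add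
      (((i0.const_sub 1).mul q1).const_mul k)).const_mul D)).sub
      ((((q0.pow 2).const_mul (-2 * k)).add ((q1.pow 2).const_mul (2 * k))).const_mul G)).const_mul
        m).congr_deriv ?_
    push_cast
    ring
  · intro x hx
    exact lt_of_lt_of_le (by positivity) (hb x hx)
  · intro x hx
    refine (hL x hx).trans ?_
    have hB := mul_nonneg (sub_nonneg.2 (hb x hx)) (B0 x (Ioo_subset_Icc_self hx))
    rw [← sub_nonneg]
    refine hB.trans (le_of_eq ?_)
    have hK1 : K = c ^ 2 * C := hC1.symm
    have hK2 : K * (m * ε * (e0 x + e1 x)) = 2 * c * D * (m * ε * (e0 x + e1 x)) := by rw [hD1]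
    have hK3 : K * (m * (e0 x ^ 2 + e1 x ^ 2)) = 3 * c ^ 2 * G * (m * (e0 x ^ 2 + e1 x ^ 2)) := by
      rw [hG1]
    have hK4 : K * (1 + m * ε * (e0 x + e1 x) + m * (e0 x ^ 2 + e1 x ^ 2)) =
      c ^ 2 * C + 2 * c * D * (m * ε * (e0 x + e1 x))
        + 3 * c ^ 2 * G * (m * (e0 x ^ 2 + e1 x ^ 2)) := by
      rw [← hK2, ← hK3, hC1]; ring
    rw [hK4, ← hkε]
    ring
  · refine h0.trans ?_
    have a1 : e1 0 ^ 2 ≤ e1 0 := by nlinarith [e1p 0, e1le 0 (by simp)]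
    have a2 : 0 ≤ G * (e1 0 - e1 0 ^ 2) := mul_nonneg hG0 (by linarith)
    have a3 := mul_nonneg hK (e1p 0)
    have a4 := mul_nonneg hD0 (e1p 0)
    rw [e00]
    have := mul_nonneg hm (add_nonneg (add_nonneg a2 a3) a4)
    nlinarith
  · refine h1'.trans ?_
    have a1 : e0 1 ^ 2 ≤ e0 1 := by nlinarith [e0p 1, e0le 1 (by simp)]
    have a2 : 0 ≤ G * (e0 1 - e0 1 ^ 2) := mul_nonneg hG0 (by linarith)
    have a3 := mul_nonneg hK (e0p 1)
    have a4 := mul_nonneg hD0 (e0p 1)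
    rw [e11]
    have := mul_nonneg hm (add_nonneg (add_nonneg a2 a3) a4)
    nlinarith

lemma aux_barrier {c ε K m : ℝ} (hc : 0 < c) (hε : 0 < ε) (hK : 0 ≤ K) (hm : 0 ≤ m)
    {v v1 v2 b : ℝ → ℝ}
    (h1 : ∀ x ∈ Icc (0:ℝ) 1, HasDerivWithinAt v (v1 x) (Icc (0:ℝ) 1) x)
    (h2 : ∀ x ∈ Icc (0:ℝ) 1, HasDerivWithinAt v1 (v2 x) (Icc (0:ℝ) 1) x)
    (hb : ∀ x ∈ Ioo (0:ℝ) 1, c ^ 2 ≤ b x)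
    (hL : ∀ x ∈ Ioo (0:ℝ) 1, |-ε ^ 2 * v2 x + b x * v x| ≤
      K * (1 + m * ε * (exp (-c*x/ε) + exp (-c*(1-x)/ε))
        + m * (exp (-c*x/ε) ^ 2 + exp (-c*(1-x)/ε) ^ 2)))
    (h0 : |v 0| ≤ K * m) (h1' : |v 1| ≤ K * m) :
    ∀ x ∈ Icc (0:ℝ) 1,
      |v x| ≤ auxCb c K * (1 + m * (exp (-c*x/ε) + exp (-c*(1-x)/ε))) := by
  have de0 : ∀ x : ℝ, HasDerivAt (fun x => exp (-c*x/ε)) (-(c/ε) * exp (-c*x/ε)) x := by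
    intro x
    have h : HasDerivAt (fun x : ℝ => -c*x/ε) (-(c/ε)) x := by
      have := ((hasDerivAt_id x).const_mul (-c)).div_const ε
      refine this.congr_deriv ?_
      ring
    refine h.exp.congr_deriv ?_
    ring
  have de1 : ∀ x : ℝ, HasDerivAt (fun x => exp (-c*(1-x)/ε)) ((c/ε) * exp (-c*(1-x)/ε)) x := by
    intro x
    have h : HasDerivAt (fun x : ℝ => -c*(1-x)/ε) (c/ε) x := by
      have := (((hasDerivAt_id x).const_sub 1).const_mul (-c)).div_const ε
      refine this.congr_deriv ?_
      ring
    refine h.exp.congr_deriv ?_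
    ring
  have e0le : ∀ x ∈ Icc (0:ℝ) 1, exp (-c*x/ε) ≤ 1 := by
    intro x hx
    rw [exp_le_one_iff]
    apply div_nonpos_of_nonpos_of_nonneg _ hε.le
    nlinarith [hx.1]
  have e1le : ∀ x ∈ Icc (0:ℝ) 1, exp (-c*(1-x)/ε) ≤ 1 := by
    intro x hx
    rw [exp_le_one_iff]
    apply div_nonpos_of_nonpos_of_nonneg _ hε.le
    nlinarith [hx.2]
  have e00 : exp (-c*0/ε) = 1 := by simp
  have e11 : exp (-c*(1-1)/ε) = 1 := by simp
  have e0p : ∀ x : ℝ, 0 ≤ exp (-c*x/ε) := fun x => (exp_pos _).le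
  have e1p : ∀ x : ℝ, 0 ≤ exp (-c*(1-x)/ε) := fun x => (exp_pos _).le
  exact aux_barrier0 (k := c / ε) (e0 := fun x => exp (-c*x/ε)) (e1 := fun x => exp (-c*(1-x)/ε))
    hc hε hK hm (by field_simp) de0 de1 e0le e1le e00 e11 e0p e1p h1 h2 hb hL h0 h1'

lemma aux_partials {φ : ℝ × ℝ → ℝ} {n : WithTop ℕ∞}
    (h : ContDiffOn ℝ (n + 1) φ ((Icc (0:ℝ) 1) ×ˢ (univ : Set ℝ))) :
    ∃ φx φu : ℝ × ℝ → ℝ,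
      ContDiffOn ℝ n φx ((Icc (0:ℝ) 1) ×ˢ (univ : Set ℝ)) ∧
      ContDiffOn ℝ n φu ((Icc (0:ℝ) 1) ×ˢ (univ : Set ℝ)) ∧
      (∀ (u : ℝ → ℝ) (u' x : ℝ), x ∈ Icc (0:ℝ) 1 → HasDerivWithinAt u u' (Icc (0:ℝ) 1) x →
        HasDerivWithinAt (fun t => φ (t, u t)) (φx (x, u x) + φu (x, u x) * u') (Icc (0:ℝ) 1) x) ∧
      ∀ x ∈ Icc (0:ℝ) 1, ∀ y, HasDerivAt (fun z => φ (x, z)) (φu (x, y)) y := by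
  have hu : UniqueDiffOn ℝ ((Icc (0:ℝ) 1) ×ˢ (univ : Set ℝ)) :=
    (uniqueDiffOn_Icc zero_lt_one).prod uniqueDiffOn_univ
  have hd := h.fderivWithin hu le_rfl
  have hD : ∀ p ∈ (Icc (0:ℝ) 1) ×ˢ (univ : Set ℝ), HasFDerivWithinAt φ
      (fderivWithin ℝ φ ((Icc (0:ℝ) 1) ×ˢ (univ : Set ℝ)) p) ((Icc (0:ℝ) 1) ×ˢ (univ : Set ℝ)) p :=
    fun p hp => ((h.differentiableOn (by simp)) p hp).hasFDerivWithinAt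
  refine ⟨fun p => fderivWithin ℝ φ ((Icc (0:ℝ) 1) ×ˢ (univ : Set ℝ)) p (1, 0),
    fun p => fderivWithin ℝ φ ((Icc (0:ℝ) 1) ×ˢ (univ : Set ℝ)) p (0, 1),
    hd.clm_apply contDiffOn_const, hd.clm_apply contDiffOn_const, ?_, ?_⟩
  · intro u u' x hx hux
    have h1 : HasDerivWithinAt (fun t => (t, u t)) ((1:ℝ), u') (Icc (0:ℝ) 1) x :=
      (hasDerivWithinAt_id x _).prodMk hux
    have h2 := (hD (x, u x) ⟨hx, mem_univ _⟩).comp_hasDerivWithinAt x h1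
      (t := (Icc (0:ℝ) 1) ×ˢ (univ : Set ℝ)) (fun t ht => Set.mk_mem_prod ht (mem_univ _))
    refine h2.congr_deriv ?_
    have : ((1:ℝ), u') = (1, 0) + u' • ((0:ℝ), (1:ℝ)) := by simp
    rw [this, map_add, map_smul, smul_eq_mul, mul_comm]
  · intro x hx y
    have h1 : HasDerivWithinAt (fun t => (x, t)) ((0:ℝ), (1:ℝ)) univ y :=
      (hasDerivWithinAt_const y _ x).prodMk (hasDerivWithinAt_id y _)
    have h2 := (hD (x, y) ⟨hx, mem_univ _⟩).comp_hasDerivWithinAt y h1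
      (t := (Icc (0:ℝ) 1) ×ˢ (univ : Set ℝ)) (fun t ht => Set.mk_mem_prod hx (mem_univ _))
    exact h2.hasDerivAt Filter.univ_mem

lemma aux_bound (l : ℝ) (L : List (ℝ × ℝ → ℝ))
    (hL : ∀ φ ∈ L, ContinuousOn φ ((Icc (0:ℝ) 1) ×ˢ (univ : Set ℝ))) :
    ∃ M : ℝ, 1 ≤ M ∧ ∀ φ ∈ L, ∀ x ∈ Icc (0:ℝ) 1, ∀ y, |y| ≤ l → |φ (x, y)| ≤ M := by
  induction L with
  | nil => exact ⟨1, le_rfl, by simp⟩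
  | cons φ L ih =>
    obtain ⟨M, hM, h⟩ := ih (fun ψ hψ => hL ψ (List.mem_cons_of_mem _ hψ))
    have hc : ContinuousOn φ ((Icc (0:ℝ) 1) ×ˢ (Icc (-l) l)) :=
      (hL φ List.mem_cons_self).mono (prod_mono subset_rfl (subset_univ _))
    obtain ⟨N, hN⟩ := (isCompact_Icc.prod isCompact_Icc).exists_bound_of_continuousOn hc
    refine ⟨max M N, hM.trans (le_max_left _ _), ?_⟩
    intro ψ hψ x hx y hy
    rcases List.mem_cons.1 hψ with rfl | h'
    · exact (hN (x, y) ⟨hx, abs_le.1 hy⟩).trans (le_max_right _ _)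
    · exact (h ψ h' x hx y hy).trans (le_max_left _ _)

lemma aux_slope_s1 {u u1 u2 : ℝ → ℝ} {ε l N a : ℝ} (hε : 0 < ε)
    (h1 : ∀ x ∈ Icc (0:ℝ) 1, HasDerivWithinAt u (u1 x) (Icc (0:ℝ) 1) x)
    (h2 : ∀ x ∈ Icc (0:ℝ) 1, HasDerivWithinAt u1 (u2 x) (Icc (0:ℝ) 1) x)
    (hl : ∀ x ∈ Icc (0:ℝ) 1, |u x| ≤ l) (hN : ∀ x ∈ Icc (0:ℝ) 1, |u2 x| ≤ N / ε ^ 2)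
    (ha : 0 ≤ a) (ha' : a + ε ≤ 1) : ∀ x ∈ Icc a (a + ε), |u1 x| ≤ (2 * l + N) / ε := by
  intro x hx
  have hsub : Icc a (a + ε) ⊆ Icc (0:ℝ) 1 := Icc_subset_Icc ha ha'
  have hN0 : 0 ≤ N / ε ^ 2 := (abs_nonneg _).trans (hN x (hsub hx))
  obtain ⟨ξ, hξ, he⟩ := exists_hasDerivAt_eq_slope u u1 (a := a) (b := a + ε) (by linarith)
    (fun y hy => ((h1 y (hsub hy)).mono hsub).continuousWithinAt)
    (fun y hy => (h1 y (hsub (Ioo_subset_Icc_self hy))).hasDerivAt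
      (Icc_mem_nhds (by linarith [hy.1]) (by linarith [hy.2])))
  have hξ' := Ioo_subset_Icc_self hξ
  have h3 := (convex_Icc (0:ℝ) 1).norm_image_sub_le_of_norm_hasDerivWithin_le h2 hN
    (hsub hξ') (hsub hx)
  rw [Real.norm_eq_abs, Real.norm_eq_abs] at h3
  have h4 : |x - ξ| ≤ ε := by
    rw [abs_le]; constructor <;> linarith [hx.1, hx.2, hξ.1, hξ.2]
  have h5 : N / ε ^ 2 * |x - ξ| ≤ N / ε := by
    calc _ ≤ N / ε ^ 2 * ε := by gcongr
      _ = N / ε := by field_simp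
  have h6 : |u1 ξ| ≤ 2 * l / ε := by
    rw [he, abs_div]
    have : a + ε - a = ε := by ring
    rw [this, abs_of_pos hε]
    gcongr
    have q1 := abs_le.1 (hl _ (hsub (left_mem_Icc.2 (by linarith : a ≤ a + ε))))
    have q2 := abs_le.1 (hl _ (hsub (right_mem_Icc.2 (by linarith : a ≤ a + ε))))
    rw [abs_le]; constructor <;> linarith
  have h7 : |u1 x| ≤ |u1 x - u1 ξ| + |u1 ξ| := by
    have := abs_add_le (u1 x - u1 ξ) (u1 ξ); simpa using this
  rw [add_div]; linarith

lemma aux_term {a w M T : ℝ} (hM : 0 ≤ M) (ha : |a| ≤ M) (hw : |w| ≤ T) :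
    -(M * T) ≤ a * w ∧ a * w ≤ M * T := by
  rw [← abs_le, abs_mul]
  exact mul_le_mul ha hw (abs_nonneg _) hM

lemma aux_g2 {M C q E S p a1 a2 a3 a4 : ℝ} (hM : 1 ≤ M) (hC : 1 ≤ C) (hq : 1 ≤ q)
    (hE : 0 ≤ E) (hS : E ^ 2 ≤ 2 * S) (hp : |p| ≤ C * (1 + q * E))
    (h1 : |a1| ≤ M) (h2 : |a2| ≤ M) (h3 : |a3| ≤ M) (h4 : |a4| ≤ M) :
    |-(a1 + a2 * p + (a3 + a4 * p) * p)| ≤ 16 * M * C ^ 2 * (1 + q * E + q ^ 2 * S) := by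
  have hS0 : 0 ≤ S := by nlinarith [sq_nonneg E]
  have hqE : 0 ≤ q * E := by positivity
  obtain ⟨R, hR⟩ : ∃ R, R = 1 + q * E + q ^ 2 * S := ⟨_, rfl⟩
  have hqS : 0 ≤ q ^ 2 * S := by positivity
  have hR1 : 1 ≤ R := by linarith
  have hC2 : C ≤ C ^ 2 := by nlinarith
  have t1 : |(1:ℝ)| ≤ 4 * C ^ 2 * R := by rw [abs_one]; nlinarith
  have t2 : |p| ≤ 4 * C ^ 2 * R := by
    refine hp.trans ?_
    calc C * (1 + q * E) ≤ C ^ 2 * R := by gcongr; linarith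
      _ ≤ _ := by nlinarith [mul_nonneg (sq_nonneg C) (by linarith : 0 ≤ R)]
  have t3 : |p * p| ≤ 4 * C ^ 2 * R := by
    rw [abs_mul]
    calc |p| * |p| ≤ (C * (1 + q * E)) * (C * (1 + q * E)) := by gcongr
      _ = C ^ 2 * (1 + q * E) ^ 2 := by ring
      _ ≤ C ^ 2 * (4 * R) := by
        gcongr
        have : q ^ 2 * E ^ 2 ≤ q ^ 2 * (2 * S) := by gcongr
        nlinarith
      _ = _ := by ring
  have hM0 : 0 ≤ M := by linarith
  have s1 := aux_term hM0 h1 t1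
  have s2 := aux_term hM0 h2 t2
  have s3 := aux_term hM0 h3 t2
  have s4 := aux_term hM0 h4 t3
  rw [← hR]
  have e : 16 * M * C ^ 2 * R = 4 * (M * (4 * C ^ 2 * R)) := by ring
  rw [e, abs_le]
  constructor <;> linarith [s1.1, s1.2, s2.1, s2.2, s3.1, s3.2, s4.1, s4.2]

set_option maxHeartbeats 4000000 in
lemma aux_g3 {M C q E S p r xxx xxu xux xuu uxx uxu uux uuu xu ux uu : ℝ}
    (hM : 1 ≤ M) (hC : 1 ≤ C) (hq : 1 ≤ q)
    (hE : 0 ≤ E) (hE2 : E ≤ 2) (hS : E ^ 2 ≤ 2 * S) (hp : |p| ≤ C * (1 + q * E))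
    (hr : |r| ≤ C * (1 + q ^ 2 * E))
    (h1 : |xxx| ≤ M) (h2 : |xxu| ≤ M) (h3 : |xux| ≤ M) (h4 : |xuu| ≤ M)
    (h5 : |uxx| ≤ M) (h6 : |uxu| ≤ M) (h7 : |uux| ≤ M) (h8 : |uuu| ≤ M)
    (h9 : |xu| ≤ M) (h10 : |ux| ≤ M) (h11 : |uu| ≤ M) :
    |-(xxx + xxu * p + ((xux + xuu * p) * p + xu * r)
        + (((uxx + uxu * p) + ((uux + uuu * p) * p + uu * r)) * p + (ux + uu * p) * r)
        + (ux + uu * p) * r)| ≤ 224 * M * C ^ 3 * (1 + q ^ 2 * E + q ^ 3 * S) := by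
  have hS0 : 0 ≤ S := by nlinarith [sq_nonneg E]
  obtain ⟨R, hR⟩ : ∃ R, R = 1 + q ^ 2 * E + q ^ 3 * S := ⟨_, rfl⟩
  have hqE : 0 ≤ q * E := by positivity
  have hqE2 : q * E ≤ q ^ 2 * E := by nlinarith
  have hq3 : q ^ 2 ≤ q ^ 3 := by nlinarith [sq_nonneg q]
  have hqS : 0 ≤ q ^ 3 * S := by positivity
  have hqS2 : q ^ 2 * S ≤ q ^ 3 * S := by gcongr
  have hR1 : 1 ≤ R := by linarith
  have hR0 : 0 ≤ R := by linarith
  have hC2 : C ≤ C ^ 2 := by nlinarith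
  have hC3 : C ^ 2 ≤ C ^ 3 := by nlinarith [sq_nonneg C]
  have hC13 : C ≤ C ^ 3 := by linarith
  have hCR : 0 ≤ C ^ 3 * R := by positivity
  have hM0 : 0 ≤ M := by linarith
  have w1 : 1 + q * E ≤ R := by linarith
  have w1' : 1 + q ^ 2 * E ≤ R := by linarith
  have z2 : q ^ 2 * E ^ 2 ≤ q ^ 2 * (2 * S) := by gcongr
  have z3 : q ^ 3 * E ^ 2 ≤ q ^ 3 * (2 * S) := by gcongr
  have z4 : q ^ 3 * E ^ 2 * E ≤ q ^ 3 * E ^ 2 * 2 := by gcongr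
  have w2 : (1 + q * E) ^ 2 ≤ 16 * R := by nlinarith
  have w3 : (1 + q * E) ^ 3 ≤ 16 * R := by nlinarith
  have w4 : (1 + q * E) * (1 + q ^ 2 * E) ≤ 16 * R := by nlinarith
  have t1 : |(1:ℝ)| ≤ 16 * C ^ 3 * R := by
    have : 1 ≤ C ^ 3 * R := one_le_mul_of_one_le_of_one_le (by linarith) hR1
    rw [abs_one]; linarith
  have t2 : |p| ≤ 16 * C ^ 3 * R := by
    refine hp.trans ?_
    calc C * (1 + q * E) ≤ C ^ 3 * R := by gcongr
      _ ≤ _ := by linarith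
  have t2' : |r| ≤ 16 * C ^ 3 * R := by
    refine hr.trans ?_
    calc C * (1 + q ^ 2 * E) ≤ C ^ 3 * R := by gcongr
      _ ≤ _ := by linarith
  have t3 : |p * p| ≤ 16 * C ^ 3 * R := by
    rw [abs_mul]
    calc |p| * |p| ≤ (C * (1 + q * E)) * (C * (1 + q * E)) := by gcongr
      _ = C ^ 2 * (1 + q * E) ^ 2 := by ring
      _ ≤ C ^ 3 * (16 * R) := by gcongr
      _ = _ := by ring
  have t4 : |p * p * p| ≤ 16 * C ^ 3 * R := by
    rw [abs_mul, abs_mul]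
    calc |p| * |p| * |p| ≤ (C * (1 + q * E)) * (C * (1 + q * E)) * (C * (1 + q * E)) := by gcongr
      _ = C ^ 3 * (1 + q * E) ^ 3 := by ring
      _ ≤ C ^ 3 * (16 * R) := by gcongr
      _ = _ := by ring
  have t5 : |p * r| ≤ 16 * C ^ 3 * R := by
    rw [abs_mul]
    calc |p| * |r| ≤ (C * (1 + q * E)) * (C * (1 + q ^ 2 * E)) := by gcongr
      _ = C ^ 2 * ((1 + q * E) * (1 + q ^ 2 * E)) := by ring
      _ ≤ C ^ 3 * (16 * R) := by gcongr
      _ = _ := by ring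
  have s1 := abs_le.2 (aux_term hM0 h1 t1)
  have s2 := abs_le.2 (aux_term hM0 h2 t2)
  have s3 := abs_le.2 (aux_term hM0 h3 t2)
  have s4 := abs_le.2 (aux_term hM0 h4 t3)
  have s5 := abs_le.2 (aux_term hM0 h9 t2')
  have s6 := abs_le.2 (aux_term hM0 h5 t2)
  have s7 := abs_le.2 (aux_term hM0 h6 t3)
  have s8 := abs_le.2 (aux_term hM0 h7 t3)
  have s9 := abs_le.2 (aux_term hM0 h8 t4)
  have s10 := abs_le.2 (aux_term hM0 h11 t5)
  have s11 := abs_le.2 (aux_term hM0 h10 t2')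
  rw [← hR]
  have e : 224 * M * C ^ 3 * R = 14 * (M * (16 * C ^ 3 * R)) := by ring
  rw [e]
  rw [abs_le] at *
  constructor <;> linarith [s1.1, s1.2, s2.1, s2.2, s3.1, s3.2, s4.1, s4.2, s5.1, s5.2, s6.1, s6.2,
    s7.1, s7.2, s8.1, s8.2, s9.1, s9.2, s10.1, s10.2, s11.1, s11.2]

set_option maxHeartbeats 4000000 in
/-- ε-uniform bounds on the derivatives `u^{(j)}`, `j = 1,2,3`,
of the solution of the BVP. -/
theorem stmt_1 (f : ℝ → ℝ → ℝ) (c₀ : ℝ) (hc₀ : 0 < c₀)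
    (hf : SmoothF f) (hfu : LowerF f c₀) :
    ∃ C : ℝ, 0 < C ∧
      ∀ ε ∈ Ioc (0:ℝ) 1, ∀ u : ℝ → ℝ, IsSolution f ε u →
        ∀ j ∈ ({1, 2, 3} : Set ℕ), ∀ x ∈ Icc (0:ℝ) 1,
          |iteratedDerivWithin j u (Icc (0:ℝ) 1) x| ≤
            C * (1 + ε ^ (-(j:ℤ)) *
              (Real.exp (-c₀*x/ε) + Real.exp (-c₀*(1-x)/ε))) := by
  have hf4 : ContDiffOn ℝ (3 + 1) (fun p : ℝ × ℝ => f p.1 p.2)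
      ((Icc (0:ℝ) 1) ×ˢ (univ : Set ℝ)) := by
    have e : ((3:WithTop ℕ∞) + 1) = 4 := by norm_num
    rw [e]; exact hf
  obtain ⟨fx, fu, hfx, hfu', df, dfu⟩ := aux_partials hf4
  have e3 : (3:WithTop ℕ∞) = 2 + 1 := by norm_num
  have e2 : (2:WithTop ℕ∞) = 1 + 1 := by norm_num
  have e1 : (1:WithTop ℕ∞) = 0 + 1 := by norm_num
  rw [e3] at hfx hfu'
  obtain ⟨fxx, fxu, hfxx, hfxu, dfx, -⟩ := aux_partials hfx
  obtain ⟨fux, fuu, hfux, hfuu, dfu', -⟩ := aux_partials hfu'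
  rw [e2] at hfxx hfxu hfux hfuu
  obtain ⟨fxxx, fxxu, hfxxx, hfxxu, dfxx, -⟩ := aux_partials hfxx
  obtain ⟨fxux, fxuu, hfxux, hfxuu, dfxu, -⟩ := aux_partials hfxu
  obtain ⟨fuxx, fuxu, hfuxx, hfuxu, dfux, -⟩ := aux_partials hfux
  obtain ⟨fuux, fuuu, hfuux, hfuuu, dfuu, -⟩ := aux_partials hfuu
  obtain ⟨N0, hN0, hN⟩ := aux_bound 0 [fun p : ℝ × ℝ => f p.1 p.2]
    (by intro φ hφ; simp only [List.mem_singleton] at hφ; subst hφ; exact hf.continuousOn)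
  have hfuc : ∀ x ∈ Icc (0:ℝ) 1, ∀ y, c₀ ^ 2 ≤ fu (x, y) := by
    intro x hx y
    have h1 := hfu x hx y
    have h2 : pderiv1 f x y = fu (x, y) := (dfu x hx y).deriv
    rwa [h2] at h1
  obtain ⟨l, hl⟩ : ∃ l, l = N0 / c₀ ^ 2 := ⟨_, rfl⟩
  have hl0 : 0 ≤ l := by rw [hl]; positivity
  have hlN : c₀ ^ 2 * l = N0 := by rw [hl]; field_simp
  obtain ⟨M, hM1, hM⟩ := aux_bound l [fun p : ℝ × ℝ => f p.1 p.2, fx, fu, fxx, fxu, fux, fuu,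
    fxxx, fxxu, fxux, fxuu, fuxx, fuxu, fuux, fuuu] (by
      intro φ hφ
      simp only [List.mem_cons, List.not_mem_nil, or_false] at hφ
      rcases hφ with rfl | rfl | rfl | rfl | rfl | rfl | rfl | rfl | rfl | rfl | rfl | rfl | rfl |
        rfl | rfl
      all_goals first
        | exact hf.continuousOn
        | exact hfx.continuousOn
        | exact hfu'.continuousOn
        | exact hfxx.continuousOn
        | exact hfxu.continuousOn
        | exact hfux.continuousOn
        | exact hfuu.continuousOn
        | exact hfxxx.continuousOn
        | exact hfxxu.continuousOn
        | exact hfxux.continuousOn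
        | exact hfxuu.continuousOn
        | exact hfuxx.continuousOn
        | exact hfuxu.continuousOn
        | exact hfuux.continuousOn
        | exact hfuuu.continuousOn)
  have hM0 : 0 ≤ M := by linarith
  obtain ⟨K1, hK1⟩ : ∃ K1, K1 = 2 * l + M := ⟨_, rfl⟩
  obtain ⟨C1, hC1⟩ : ∃ C1, C1 = max 1 (auxCb c₀ K1) := ⟨_, rfl⟩
  obtain ⟨K2, hK2⟩ : ∃ K2, K2 = 16 * M * C1 ^ 2 := ⟨_, rfl⟩
  obtain ⟨C2, hC2⟩ : ∃ C2, C2 = max C1 (auxCb c₀ K2) := ⟨_, rfl⟩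
  obtain ⟨K3, hK3⟩ : ∃ K3, K3 = 224 * M * C2 ^ 3 + M + M * K1 := ⟨_, rfl⟩
  obtain ⟨C3, hC3⟩ : ∃ C3, C3 = max C2 (auxCb c₀ K3) := ⟨_, rfl⟩
  have hC1o : 1 ≤ C1 := by rw [hC1]; exact le_max_left _ _
  have hC12 : C1 ≤ C2 := by rw [hC2]; exact le_max_left _ _
  have hC23 : C2 ≤ C3 := by rw [hC3]; exact le_max_left _ _
  have hC2o : 1 ≤ C2 := hC1o.trans hC12
  have hK1M : M ≤ K1 := by linarith
  have hK10 : 0 ≤ K1 := by linarith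
  have hK2M : M ≤ K2 := by
    rw [hK2]
    have : 1 ≤ C1 ^ 2 := one_le_pow₀ hC1o
    nlinarith
  have hK20 : 0 ≤ K2 := by linarith
  have hP3 : 0 ≤ 224 * M * C2 ^ 3 := by positivity
  have hMK : 0 ≤ M * K1 := by positivity
  have hK30 : 0 ≤ K3 := by linarith
  refine ⟨C3, by linarith, ?_⟩
  rintro ε ⟨hε, hε1⟩ u ⟨hu, hode, hu0, hu1⟩
  have huD : UniqueDiffOn ℝ (Icc (0:ℝ) 1) := uniqueDiffOn_Icc zero_lt_one
  have hstep : ∀ k : ℕ, (k : WithTop ℕ∞) < 4 → ∀ x ∈ Icc (0:ℝ) 1,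
      HasDerivWithinAt (iteratedDerivWithin k u (Icc (0:ℝ) 1))
        (iteratedDerivWithin (k + 1) u (Icc (0:ℝ) 1) x) (Icc (0:ℝ) 1) x := by
    intro k hk x hx
    rw [iteratedDerivWithin_succ]
    exact (hu.differentiableOn_iteratedDerivWithin hk huD x hx).hasDerivWithinAt
  have d0 : ∀ x ∈ Icc (0:ℝ) 1, HasDerivWithinAt u
      (iteratedDerivWithin 1 u (Icc (0:ℝ) 1) x) (Icc (0:ℝ) 1) x := by
    have := hstep 0 (by norm_num)
    simpa only [iteratedDerivWithin_zero] using this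
  have d1 : ∀ x ∈ Icc (0:ℝ) 1, HasDerivWithinAt (iteratedDerivWithin 1 u (Icc (0:ℝ) 1))
      (iteratedDerivWithin 2 u (Icc (0:ℝ) 1) x) (Icc (0:ℝ) 1) x := hstep 1 (by norm_num)
  have d2 : ∀ x ∈ Icc (0:ℝ) 1, HasDerivWithinAt (iteratedDerivWithin 2 u (Icc (0:ℝ) 1))
      (iteratedDerivWithin 3 u (Icc (0:ℝ) 1) x) (Icc (0:ℝ) 1) x := hstep 2 (by norm_num)
  have d3 : ∀ x ∈ Icc (0:ℝ) 1, HasDerivWithinAt (iteratedDerivWithin 3 u (Icc (0:ℝ) 1))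
      (iteratedDerivWithin 4 u (Icc (0:ℝ) 1) x) (Icc (0:ℝ) 1) x := hstep 3 (by norm_num)
  suffices hsuff : ∀ x ∈ Icc (0:ℝ) 1,
      |iteratedDerivWithin 1 u (Icc (0:ℝ) 1) x| ≤
        C1 * (1 + ε⁻¹ * (exp (-c₀*x/ε) + exp (-c₀*(1-x)/ε))) ∧
      |iteratedDerivWithin 2 u (Icc (0:ℝ) 1) x| ≤
        C2 * (1 + ε⁻¹ ^ 2 * (exp (-c₀*x/ε) + exp (-c₀*(1-x)/ε))) ∧
      |iteratedDerivWithin 3 u (Icc (0:ℝ) 1) x| ≤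
        C3 * (1 + ε⁻¹ ^ 3 * (exp (-c₀*x/ε) + exp (-c₀*(1-x)/ε))) by
    intro j hj x hx
    obtain ⟨r1, r2, r3⟩ := hsuff x hx
    rw [zpow_neg, zpow_natCast, ← inv_pow]
    simp only [mem_insert_iff, mem_singleton_iff] at hj
    rcases hj with rfl | rfl | rfl
    · refine r1.trans ?_
      rw [pow_one]
      gcongr
      exact hC12.trans hC23
    · refine r2.trans ?_
      gcongr
    · exact r3
  generalize iteratedDerivWithin 1 u (Icc (0:ℝ) 1) = u1 at *
  generalize iteratedDerivWithin 2 u (Icc (0:ℝ) 1) = u2 at *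
  generalize iteratedDerivWithin 3 u (Icc (0:ℝ) 1) = u3 at *
  generalize iteratedDerivWithin 4 u (Icc (0:ℝ) 1) = u4 at *
  have hεne : ε ≠ 0 := hε.ne'
  have hε2 : 0 < ε ^ 2 := by positivity
  -- the equation holds up to the boundary
  have dF : ∀ x ∈ Icc (0:ℝ) 1, HasDerivWithinAt (fun t => f t (u t))
      (fx (x, u x) + fu (x, u x) * u1 x) (Icc (0:ℝ) 1) x := fun x hx =>
    df u (u1 x) x hx (d0 x hx)
  have eq2 : ∀ x ∈ Icc (0:ℝ) 1, ε ^ 2 * u2 x = f x (u x) := by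
    have h : EqOn (fun x => ε ^ 2 * u2 x) (fun x => f x (u x)) (Ioo (0:ℝ) 1) := fun x hx => by
      have := hode x hx
      simp only
      linarith
    refine h.of_subset_closure
      (fun x hx => ((d2 x hx).const_mul (ε ^ 2)).continuousWithinAt)
      (fun x hx => (dF x hx).continuousWithinAt) Ioo_subset_Icc_self ?_
    rw [closure_Ioo (by norm_num)]
  have eq3 : ∀ x ∈ Icc (0:ℝ) 1, ε ^ 2 * u3 x = fx (x, u x) + fu (x, u x) * u1 x := fun x hx =>
    (huD x hx).eq_deriv _ ((d2 x hx).const_mul (ε ^ 2))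
      ((dF x hx).congr (fun y hy => eq2 y hy) (eq2 x hx))
  have dF1 : ∀ x ∈ Icc (0:ℝ) 1, HasDerivWithinAt (fun t => fx (t, u t) + fu (t, u t) * u1 t)
      (fxx (x, u x) + fxu (x, u x) * u1 x +
        ((fux (x, u x) + fuu (x, u x) * u1 x) * u1 x + fu (x, u x) * u2 x)) (Icc (0:ℝ) 1) x :=
    fun x hx => (dfx u (u1 x) x hx (d0 x hx)).add ((dfu' u (u1 x) x hx (d0 x hx)).mul (d1 x hx))
  have eq4 : ∀ x ∈ Icc (0:ℝ) 1, ε ^ 2 * u4 x = fxx (x, u x) + fxu (x, u x) * u1 x +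
        ((fux (x, u x) + fuu (x, u x) * u1 x) * u1 x + fu (x, u x) * u2 x) := fun x hx =>
    (huD x hx).eq_deriv _ ((d3 x hx).const_mul (ε ^ 2))
      ((dF1 x hx).congr (fun y hy => eq3 y hy) (eq3 x hx))
  have dF2 : ∀ x ∈ Icc (0:ℝ) 1, HasDerivWithinAt (fun t => fxx (t, u t) + fxu (t, u t) * u1 t +
        ((fux (t, u t) + fuu (t, u t) * u1 t) * u1 t + fu (t, u t) * u2 t))
      ((fxxx (x, u x) + fxxu (x, u x) * u1 x +
        ((fxux (x, u x) + fxuu (x, u x) * u1 x) * u1 x + fxu (x, u x) * u2 x)) +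
        ((((fuxx (x, u x) + fuxu (x, u x) * u1 x) +
          ((fuux (x, u x) + fuuu (x, u x) * u1 x) * u1 x + fuu (x, u x) * u2 x)) * u1 x +
          (fux (x, u x) + fuu (x, u x) * u1 x) * u2 x) +
         ((fux (x, u x) + fuu (x, u x) * u1 x) * u2 x + fu (x, u x) * u3 x)))
        (Icc (0:ℝ) 1) x := by
    intro x hx
    have i0 := d0 x hx
    have i1 := d1 x hx
    have i2 := d2 x hx
    exact ((dfxx u _ x hx i0).add ((dfxu u _ x hx i0).mul i1)).add
      ((((dfux u _ x hx i0).add ((dfuu u _ x hx i0).mul i1)).mul i1).add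
        ((dfu' u _ x hx i0).mul i2))
  have d4 : ∀ x ∈ Icc (0:ℝ) 1, HasDerivWithinAt u4 ((ε ^ 2)⁻¹ *
      ((fxxx (x, u x) + fxxu (x, u x) * u1 x +
        ((fxux (x, u x) + fxuu (x, u x) * u1 x) * u1 x + fxu (x, u x) * u2 x)) +
        ((((fuxx (x, u x) + fuxu (x, u x) * u1 x) +
          ((fuux (x, u x) + fuuu (x, u x) * u1 x) * u1 x + fuu (x, u x) * u2 x)) * u1 x +
          (fux (x, u x) + fuu (x, u x) * u1 x) * u2 x) +
         ((fux (x, u x) + fuu (x, u x) * u1 x) * u2 x + fu (x, u x) * u3 x))))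
        (Icc (0:ℝ) 1) x := by
    intro x hx
    have h : ∀ y ∈ Icc (0:ℝ) 1, u4 y = (ε ^ 2)⁻¹ * (fxx (y, u y) + fxu (y, u y) * u1 y +
        ((fux (y, u y) + fuu (y, u y) * u1 y) * u1 y + fu (y, u y) * u2 y)) := by
      intro y hy
      rw [← eq4 y hy]; field_simp
    exact ((dF2 x hx).const_mul (ε ^ 2)⁻¹).congr h (h x hx)
  -- bound on u
  have hul : ∀ x ∈ Icc (0:ℝ) 1, |u x| ≤ l := by
    have hmv : ∀ x : ℝ, ∃ β : ℝ, x ∈ Icc (0:ℝ) 1 →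
        c₀ ^ 2 ≤ β ∧ f x (u x) - f x 0 = β * u x := by
      intro x
      by_cases hx : x ∈ Icc (0:ℝ) 1
      swap
      · exact ⟨0, fun h => absurd h hx⟩
      have hc : Continuous (fun z => f x z) :=
        continuous_iff_continuousAt.2 fun y => (dfu x hx y).continuousAt
      rcases lt_trichotomy (u x) 0 with h | h | h
      · obtain ⟨ξ, -, hξ⟩ := exists_hasDerivAt_eq_slope (fun z => f x z) (fun z => fu (x, z)) h
          hc.continuousOn (fun y _ => dfu x hx y)
        refine ⟨fu (x, ξ), fun _ => ⟨hfuc x hx ξ, ?_⟩⟩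
        have : u x ≠ 0 := h.ne
        rw [hξ, zero_sub]; field_simp; ring
      · exact ⟨c₀ ^ 2, fun _ => ⟨le_rfl, by rw [h]; ring⟩⟩
      · obtain ⟨ξ, -, hξ⟩ := exists_hasDerivAt_eq_slope (fun z => f x z) (fun z => fu (x, z)) h
          hc.continuousOn (fun y _ => dfu x hx y)
        refine ⟨fu (x, ξ), fun _ => ⟨hfuc x hx ξ, ?_⟩⟩
        have : u x ≠ 0 := h.ne'
        rw [hξ, sub_zero]; field_simp
    choose β hβ using hmv
    refine aux_comp hε (b := β) (B := fun _ => l) (B1 := fun _ => 0) (B2 := fun _ => 0) d0 d1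
      (fun x hx => hasDerivWithinAt_const _ _ _) (fun x hx => hasDerivWithinAt_const _ _ _)
      (fun x hx => lt_of_lt_of_le (by positivity) (hβ x (Ioo_subset_Icc_self hx)).1) ?_
      (by rw [hu0, abs_zero]; exact hl0) (by rw [hu1, abs_zero]; exact hl0)
    intro x hx
    have hx' := Ioo_subset_Icc_self hx
    obtain ⟨b1, b2⟩ := hβ x hx'
    have h3 : -ε ^ 2 * u2 x + β x * u x = -f x 0 := by
      have := eq2 x hx'
      linarith
    have h4 : |f x 0| ≤ N0 := hN _ List.mem_cons_self x hx' 0 (by simp)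
    rw [h3, abs_neg]
    have := mul_le_mul_of_nonneg_right b1 hl0
    linarith
  have bd : ∀ φ ∈ [fun p : ℝ × ℝ => f p.1 p.2, fx, fu, fxx, fxu, fux, fuu,
      fxxx, fxxu, fxux, fxuu, fuxx, fuxu, fuux, fuuu], ∀ x ∈ Icc (0:ℝ) 1, |φ (x, u x)| ≤ M :=
    fun φ hφ x hx => hM φ hφ x hx (u x) (hul x hx)
  simp only [List.forall_mem_cons] at bd
  obtain ⟨bf, bfx, bfu, bfxx, bfxu, bfux, bfuu, bfxxx, bfxxu, bfxux, bfxuu, bfuxx, bfuxu, bfuux,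
    bfuuu, -⟩ := bd
  obtain ⟨q, hq⟩ : ∃ q, q = ε⁻¹ := ⟨_, rfl⟩
  have hq1 : 1 ≤ q := by rw [hq]; exact (one_le_inv₀ hε).2 hε1
  have hq0 : 0 ≤ q := by linarith
  have hqε : q * ε = 1 := by rw [hq]; field_simp
  have bu2 : ∀ x ∈ Icc (0:ℝ) 1, |u2 x| ≤ M * q ^ 2 := by
    intro x hx
    have h : u2 x = q ^ 2 * f x (u x) := by rw [← eq2 x hx, hq]; field_simp
    rw [h, abs_mul, abs_of_nonneg (by positivity), mul_comm]
    exact mul_le_mul_of_nonneg_right (bf x hx) (by positivity)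
  have hsl := fun a ha ha' => aux_slope_s1 (a := a) hε d0 d1 hul (N := M) (by
    intro x hx
    refine (bu2 x hx).trans (le_of_eq ?_)
    rw [hq]; field_simp) ha ha'
  have bu10 : |u1 0| ≤ K1 * q := by
    have := hsl 0 le_rfl (by linarith) 0 (by constructor <;> linarith)
    rwa [hK1, hq, ← div_eq_mul_inv]
  have bu11 : |u1 1| ≤ K1 * q := by
    have := hsl (1 - ε) (by linarith) (by linarith) 1 (by constructor <;> linarith)
    rwa [hK1, hq, ← div_eq_mul_inv]
  have bu3 : ∀ x ∈ Icc (0:ℝ) 1, |u1 x| ≤ K1 * q → |u3 x| ≤ K3 * q ^ 3 := by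
    intro x hx hb
    have h : u3 x = q ^ 2 * (fx (x, u x) + fu (x, u x) * u1 x) := by
      rw [← eq3 x hx, hq]; field_simp
    have h2 : |fx (x, u x) + fu (x, u x) * u1 x| ≤ (M + M * K1) * q := by
      refine (abs_add_le _ _).trans ?_
      rw [abs_mul]
      have := mul_le_mul (bfu x hx) hb (abs_nonneg _) hM0
      have := bfx x hx
      nlinarith
    rw [h, abs_mul, abs_of_nonneg (by positivity)]
    calc q ^ 2 * |fx (x, u x) + fu (x, u x) * u1 x| ≤ q ^ 2 * ((M + M * K1) * q) := by gcongr
      _ = (M + M * K1) * q ^ 3 := by ring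
      _ ≤ K3 * q ^ 3 := by gcongr; linarith
  rw [← hq]
  have m0 : (0:ℝ) ∈ Icc (0:ℝ) 1 := by simp
  have m1 : (1:ℝ) ∈ Icc (0:ℝ) 1 := by simp
  -- first derivative
  have R1 : ∀ x ∈ Icc (0:ℝ) 1, |u1 x| ≤
      C1 * (1 + q * (exp (-c₀*x/ε) + exp (-c₀*(1-x)/ε))) := by
    intro x hx
    refine (aux_barrier hc₀ hε hK10 hq0 (b := fun x => fu (x, u x)) d1 d2
      (fun x hx => hfuc x (Ioo_subset_Icc_self hx) _) ?_ bu10 bu11 x hx).trans ?_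
    · intro x hx
      have hx' := Ioo_subset_Icc_self hx
      have h : -ε ^ 2 * u3 x + fu (x, u x) * u1 x = -fx (x, u x) := by
        have := eq3 x hx'; linarith
      rw [h, abs_neg]
      refine (bfx x hx').trans (hK1M.trans ?_)
      apply le_mul_of_one_le_right hK10
      have : 0 ≤ q * ε * (exp (-c₀*x/ε) + exp (-c₀*(1-x)/ε)) := by positivity
      have : 0 ≤ q * (exp (-c₀*x/ε) ^ 2 + exp (-c₀*(1-x)/ε) ^ 2) := by positivity
      linarith
    · gcongr
      rw [hC1]; exact le_max_right _ _
  have hEle : ∀ x ∈ Icc (0:ℝ) 1, exp (-c₀*x/ε) + exp (-c₀*(1-x)/ε) ≤ 2 := by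
    intro x hx
    have h1 : exp (-c₀*x/ε) ≤ 1 := by
      rw [exp_le_one_iff]
      apply div_nonpos_of_nonpos_of_nonneg _ hε.le
      nlinarith [hx.1]
    have h2 : exp (-c₀*(1-x)/ε) ≤ 1 := by
      rw [exp_le_one_iff]
      apply div_nonpos_of_nonpos_of_nonneg _ hε.le
      nlinarith [hx.2]
    linarith
  have hES : ∀ a b : ℝ, (a + b) ^ 2 ≤ 2 * (a ^ 2 + b ^ 2) := fun a b => by
    nlinarith [sq_nonneg (a - b)]
  have R2 : ∀ x ∈ Icc (0:ℝ) 1, |u2 x| ≤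
      C2 * (1 + q ^ 2 * (exp (-c₀*x/ε) + exp (-c₀*(1-x)/ε))) := by
    intro x hx
    have hq2 : 0 ≤ q ^ 2 := by positivity
    have hb : ∀ x ∈ Icc (0:ℝ) 1, |u2 x| ≤ K2 * q ^ 2 := fun x hx =>
      (bu2 x hx).trans (mul_le_mul_of_nonneg_right hK2M hq2)
    refine (aux_barrier hc₀ hε hK20 hq2 (b := fun x => fu (x, u x)) d2 d3
      (fun x hx => hfuc x (Ioo_subset_Icc_self hx) _) ?_ (hb 0 m0) (hb 1 m1) x hx).trans ?_
    · intro x hx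
      have hx' := Ioo_subset_Icc_self hx
      have h : -ε ^ 2 * u4 x + fu (x, u x) * u2 x = -(fxx (x, u x) + fxu (x, u x) * u1 x +
          (fux (x, u x) + fuu (x, u x) * u1 x) * u1 x) := by
        have := eq4 x hx'; linarith
      have hqq : q ^ 2 * ε = q := by rw [pow_two, mul_assoc, hqε, mul_one]
      rw [h, hK2, hqq]
      exact aux_g2 hM1 hC1o hq1 (by positivity) (hES _ _) (R1 x hx') (bfxx x hx') (bfxu x hx')
        (bfux x hx') (bfuu x hx')
    · gcongr
      rw [hC2]; exact le_max_right _ _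
  have R3 : ∀ x ∈ Icc (0:ℝ) 1, |u3 x| ≤
      C3 * (1 + q ^ 3 * (exp (-c₀*x/ε) + exp (-c₀*(1-x)/ε))) := by
    intro x hx
    have hq3 : 0 ≤ q ^ 3 := by positivity
    refine (aux_barrier hc₀ hε hK30 hq3 (b := fun x => fu (x, u x)) d3 d4
      (fun x hx => hfuc x (Ioo_subset_Icc_self hx) _) ?_ (bu3 0 m0 bu10) (bu3 1 m1 bu11)
      x hx).trans ?_
    · intro x hx
      have hx' := Ioo_subset_Icc_self hx
      have hqq : q ^ 3 * ε = q ^ 2 := by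
        have : q ^ 3 * ε = q ^ 2 * (q * ε) := by ring
        rw [this, hqε, mul_one]
      rw [hqq]
      have hp : |u1 x| ≤ C2 * (1 + q * (exp (-c₀*x/ε) + exp (-c₀*(1-x)/ε))) := by
        refine (R1 x hx').trans ?_
        gcongr
      have hg := aux_g3 hM1 hC2o hq1 (by positivity) (hEle x hx') (hES _ _) hp (R2 x hx')
        (bfxxx x hx') (bfxxu x hx') (bfxux x hx') (bfxuu x hx') (bfuxx x hx') (bfuxu x hx')
        (bfuux x hx') (bfuuu x hx') (bfxu x hx') (bfux x hx') (bfuu x hx')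
      have hcan : ∀ z : ℝ, -ε ^ 2 * ((ε ^ 2)⁻¹ * z) = -z := fun z => by field_simp
      rw [hcan]
      refine le_trans (le_of_eq ?_) (hg.trans ?_)
      · congr 1
        ring
      · gcongr
        linarith
    · gcongr
      rw [hC3]; exact le_max_right _ _
  exact fun x hx => ⟨R1 x hx, R2 x hx, R3 x hx⟩
end
end

section
/- Let u ∈ C⁴([0,1]) be the solution of the nonlinear boundary value problem, let ρ > 0, and let w : [0,1] → ℝ be continuous with max_{x∈[0,1]}|w(x) − u(x)| ≤ ρ. If v is twice continuously differentiable on [0,1], solves the quasilinearized problem −ε²v″(x) + f_u(x,w(x))·v(x) = −f(x,w(x)) + f_u(x,w(x))·w(x) on (0,1) with v(0) = v(1) = 0, then max_{x∈[0,1]}|v(x) − u(x)| ≤ c₀^{−2} θ (max_{x∈[0,1]}|w(x) − u(x)|)². -/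
open Set Real

noncomputable section

theorem aux_itd2 (g : ℝ → ℝ) (hg : ContDiffOn ℝ 2 g (Icc (0:ℝ) 1)) (x : ℝ)
    (hx : x ∈ Ioo (0:ℝ) 1) :
    iteratedDerivWithin 2 g (Icc (0:ℝ) 1) x = deriv (deriv g) x := by
  have hc : ContDiffAt ℝ 2 g x := hg.contDiffAt (Icc_mem_nhds hx.1 hx.2)
  have h2 : iteratedDerivWithin 2 g (Icc (0:ℝ) 1) x = iteratedDeriv 2 g x := by
    rw [iteratedDeriv_eq_iteratedFDeriv, iteratedDerivWithin_eq_iteratedFDerivWithin,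
      iteratedFDerivWithin_eq_iteratedFDeriv (uniqueDiffOn_Icc zero_lt_one) hc
        (Ioo_subset_Icc_self hx)]
  rw [h2, iteratedDeriv_eq_iterate]
  rfl

theorem aux_max (g : ℝ → ℝ) (hg : ContDiffOn ℝ 2 g (Icc (0:ℝ) 1)) (K : ℝ) (hK : 0 ≤ K)
    (h0 : g 0 = 0) (h1 : g 1 = 0)
    (h : ∀ x ∈ Ioo (0:ℝ) 1, 0 < g x → iteratedDerivWithin 2 g (Icc (0:ℝ) 1) x ≤ 0 → g x ≤ K) :
    ∀ x ∈ Icc (0:ℝ) 1, g x ≤ K := by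
  obtain ⟨m, hm, hmax⟩ := isCompact_Icc.exists_isMaxOn (nonempty_Icc.2 zero_le_one) hg.continuousOn
  suffices hmK : g m ≤ K from fun x hx => (hmax hx).trans hmK
  by_contra hlt
  push Not at hlt
  have hpos : 0 < g m := hK.trans_lt hlt
  have hm' : m ∈ Ioo (0:ℝ) 1 := by
    refine ⟨lt_of_le_of_ne hm.1 ?_, lt_of_le_of_ne hm.2 ?_⟩
    · rintro rfl; linarith
    · rintro rfl; linarith
  have hnh : Icc (0:ℝ) 1 ∈ nhds m := Icc_mem_nhds hm'.1 hm'.2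
  have hloc : IsLocalMax g m := hmax.isLocalMax hnh
  have hle : iteratedDerivWithin 2 g (Icc (0:ℝ) 1) m ≤ 0 := by
    rw [aux_itd2 g hg m hm']
    by_contra hp
    push Not at hp
    have hmin := isLocalMin_of_deriv_deriv_pos hp hloc.deriv_eq_zero
      (hg.contDiffAt hnh).continuousAt
    have heq : g =ᶠ[nhds m] fun _ => g m := by
      filter_upwards [hloc, hmin] with y hy1 hy2
      exact le_antisymm hy1 hy2
    have h2 := heq.deriv.deriv_eq
    simp at h2
    linarith
  exact absurd (h m hm' hpos hle) (not_le.2 hlt)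

theorem aux_absmax (g : ℝ → ℝ) (hg : ContDiffOn ℝ 2 g (Icc (0:ℝ) 1)) (K : ℝ) (hK : 0 ≤ K)
    (h0 : g 0 = 0) (h1 : g 1 = 0)
    (hp : ∀ x ∈ Ioo (0:ℝ) 1, 0 < g x → iteratedDerivWithin 2 g (Icc (0:ℝ) 1) x ≤ 0 → g x ≤ K)
    (hn : ∀ x ∈ Ioo (0:ℝ) 1, g x < 0 → 0 ≤ iteratedDerivWithin 2 g (Icc (0:ℝ) 1) x → -g x ≤ K) :
    ∀ x ∈ Icc (0:ℝ) 1, |g x| ≤ K := by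
  intro x hx
  have h2 := aux_max (-g) hg.neg K hK (by simp [h0]) (by simp [h1]) (by
    intro y hy hy1 hy2
    rw [iteratedDerivWithin_neg] at hy2
    simp only [Pi.neg_apply] at hy1 ⊢
    exact hn y hy (by linarith) (by linarith)) x hx
  have h3 := aux_max g hg K hK h0 h1 hp x hx
  simp only [Pi.neg_apply] at h2
  exact abs_le.2 ⟨by linarith, h3⟩

theorem aux_partial (F : ℝ × ℝ → ℝ) (n : ℕ)
    (hF : ContDiffOn ℝ (n + 1 : ℕ) F ((Icc (0:ℝ) 1) ×ˢ (univ : Set ℝ))) :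
    ContDiffOn ℝ n (fun p : ℝ × ℝ => deriv (fun z => F (p.1, z)) p.2)
      ((Icc (0:ℝ) 1) ×ˢ (univ : Set ℝ)) ∧
    ∀ x ∈ Icc (0:ℝ) 1, Differentiable ℝ (fun z => F (x, z)) := by
  have hs : UniqueDiffOn ℝ ((Icc (0:ℝ) 1) ×ˢ (univ : Set ℝ)) :=
    (uniqueDiffOn_Icc zero_lt_one).prod uniqueDiffOn_univ
  have key : ∀ x ∈ Icc (0:ℝ) 1, ∀ z : ℝ, HasDerivAt (fun z => F (x, z))
      (fderivWithin ℝ F ((Icc (0:ℝ) 1) ×ˢ (univ : Set ℝ)) (x, z) (0, 1)) z := by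
    intro x hx z
    have hd : DifferentiableWithinAt ℝ F ((Icc (0:ℝ) 1) ×ˢ (univ : Set ℝ)) (x, z) :=
      (hF.differentiableOn (by simp)) (x, z) ⟨hx, mem_univ _⟩
    have hc : HasDerivWithinAt (fun z : ℝ => (x, z)) ((0:ℝ), (1:ℝ)) univ z :=
      ((hasDerivAt_const z x).prodMk (hasDerivAt_id z)).hasDerivWithinAt
    have := hd.hasFDerivWithinAt.comp_hasDerivWithinAt z hc (fun y _ => ⟨hx, mem_univ _⟩)
    exact this.hasDerivAt Filter.univ_mem
  refine ⟨?_, fun x hx z => (key x hx z).differentiableAt⟩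
  have h1 : ContDiffOn ℝ n (fun p => fderivWithin ℝ F ((Icc (0:ℝ) 1) ×ˢ (univ : Set ℝ)) p (0, 1))
      ((Icc (0:ℝ) 1) ×ˢ (univ : Set ℝ)) :=
    (hF.fderivWithin hs (by norm_cast)).clm_apply contDiffOn_const
  exact h1.congr fun p hp => (key p.1 hp.1 p.2).deriv

theorem aux_mvt (g : ℝ → ℝ) (hg : Differentiable ℝ g) (a b : ℝ) :
    ∃ c ∈ uIcc a b, g b - g a = deriv g c * (b - a) := by
  rcases lt_trichotomy a b with h | h | h
  · obtain ⟨c, hc, e⟩ := exists_deriv_eq_slope g h hg.continuous.continuousOn hg.differentiableOn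
    refine ⟨c, Ioo_subset_Icc_self.trans Icc_subset_uIcc hc, ?_⟩
    rw [e, div_mul_cancel₀]
    linarith
  · subst h
    exact ⟨a, by simp, by simp⟩
  · obtain ⟨c, hc, e⟩ := exists_deriv_eq_slope g h hg.continuous.continuousOn hg.differentiableOn
    refine ⟨c, Ioo_subset_Icc_self.trans Icc_subset_uIcc' hc, ?_⟩
    rw [e]
    have : a - b ≠ 0 := by linarith
    field_simp
    ring

/-- quadratic error estimate for one step of the
Bellman–Kalaba quasilinearization. -/
theorem stmt_4 (f : ℝ → ℝ → ℝ) (c₀ : ℝ) (hc₀ : 0 < c₀)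
    (hf : SmoothF f) (hfu : LowerF f c₀)
    (ε : ℝ) (hε : ε ∈ Ioc (0:ℝ) 1)
    (u : ℝ → ℝ) (hu : IsSolution f ε u)
    (ρ : ℝ) (hρ : 0 < ρ)
    (w : ℝ → ℝ) (hw : ContinuousOn w (Icc (0:ℝ) 1))
    (hwu : ∀ x ∈ Icc (0:ℝ) 1, |w x - u x| ≤ ρ)
    (v : ℝ → ℝ) (hv : ContDiffOn ℝ 2 v (Icc (0:ℝ) 1))
    (heq : ∀ x ∈ Ioo (0:ℝ) 1,
      -ε ^ 2 * iteratedDerivWithin 2 v (Icc (0:ℝ) 1) x + pderiv1 f x (w x) * v x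
        = -f x (w x) + pderiv1 f x (w x) * w x)
    (h0 : v 0 = 0) (h1 : v 1 = 0) :
    ∀ x ∈ Icc (0:ℝ) 1,
      |v x - u x| ≤ c₀ ^ (-2 : ℤ) * thconst f c₀ ρ *
        (sSup ((fun t => |w t - u t|) '' Icc (0:ℝ) 1)) ^ 2 := by
  obtain ⟨hP1, hD1⟩ := aux_partial (fun p => f p.1 p.2) 3 (by exact_mod_cast hf)
  obtain ⟨hP2, hD2⟩ := aux_partial _ 2 (by exact_mod_cast hP1)
  obtain ⟨huC, hueq, hu0, hu1⟩ := hu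
  have huC2 : ContDiffOn ℝ 2 u (Icc (0:ℝ) 1) := huC.of_le (by norm_num)
  have hc2 : 0 < c₀ ^ 2 := by positivity
  have hcz : c₀ ^ (-2 : ℤ) = (c₀ ^ 2)⁻¹ := by
    rw [zpow_neg]; norm_cast
  have hε2 : 0 < ε ^ 2 := by have := hε.1; positivity
  have div_bound : ∀ a b : ℝ, c₀ ^ 2 * a ≤ b → a ≤ c₀ ^ (-2 : ℤ) * b := by
    intro a b hab
    rw [hcz, inv_mul_eq_div, le_div_iff₀ hc2]
    linarith
  -- bound for `u`
  have hS0 : BddAbove ((fun x => |f x 0|) '' Icc (0:ℝ) 1) := by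
    refine (isCompact_Icc.image_of_continuousOn ?_).bddAbove
    have : ContinuousOn (fun x : ℝ => f x 0) (Icc (0:ℝ) 1) :=
      hf.continuousOn.comp (f := fun x : ℝ => (x, (0:ℝ))) (by fun_prop)
        (fun x hx => ⟨hx, mem_univ _⟩)
    exact this.abs
  have hS0le : ∀ x ∈ Icc (0:ℝ) 1, |f x 0| ≤ sSup ((fun x => |f x 0|) '' Icc (0:ℝ) 1) :=
    fun x hx => le_csSup hS0 ⟨x, hx, rfl⟩
  have hl0 : 0 ≤ lconst f c₀ := by
    refine mul_nonneg (by rw [hcz]; positivity) ?_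
    exact (abs_nonneg _).trans (hS0le 0 (by simp))
  have hul : ∀ x ∈ Icc (0:ℝ) 1, |u x| ≤ lconst f c₀ := by
    refine aux_absmax u huC2 _ hl0 hu0 hu1 ?_ ?_
    · intro x hx hpos hd
      have hxI := Ioo_subset_Icc_self hx
      obtain ⟨c, -, hc⟩ := aux_mvt _ (hD1 x hxI) 0 (u x)
      have h1 : c₀ ^ 2 ≤ deriv (fun z => f x z) c := hfu x hxI c
      have h2 := hueq x hx
      have h3 := (abs_le.1 (hS0le x hxI)).1
      refine div_bound _ _ ?_
      simp only at hc
      nlinarith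
    · intro x hx hpos hd
      have hxI := Ioo_subset_Icc_self hx
      obtain ⟨c, -, hc⟩ := aux_mvt _ (hD1 x hxI) 0 (u x)
      have h1 : c₀ ^ 2 ≤ deriv (fun z => f x z) c := hfu x hxI c
      have h2 := hueq x hx
      have h3 := (abs_le.1 (hS0le x hxI)).2
      refine div_bound _ _ ?_
      simp only at hc
      nlinarith
  -- bound by theta
  have hT : BddAbove ((fun p : ℝ × ℝ => |pderiv2 f p.1 p.2|) ''
    ((Icc (0:ℝ) 1) ×ˢ (Icc (-(lconst f c₀ + 2*ρ)) (lconst f c₀ + 2*ρ)))) := by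
    refine ((isCompact_Icc.prod isCompact_Icc).image_of_continuousOn ?_).bddAbove
    have : ContinuousOn (fun p : ℝ × ℝ => pderiv2 f p.1 p.2)
      ((Icc (0:ℝ) 1) ×ˢ (Icc (-(lconst f c₀ + 2*ρ)) (lconst f c₀ + 2*ρ))) :=
      hP2.continuousOn.mono (prod_mono le_rfl (subset_univ _))
    exact this.abs
  have hTle : ∀ x ∈ Icc (0:ℝ) 1, ∀ y : ℝ, |y| ≤ lconst f c₀ + 2 * ρ →
      |pderiv2 f x y| ≤ thconst f c₀ ρ :=
    fun x hx y hy => le_csSup hT ⟨(x, y), ⟨hx, abs_le.1 hy⟩, rfl⟩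
  have hθ0 : 0 ≤ thconst f c₀ ρ :=
    (abs_nonneg _).trans (hTle 0 (by simp) 0 (by simp only [abs_zero]; linarith))
  set M := sSup ((fun t => |w t - u t|) '' Icc (0:ℝ) 1) with hM
  have hMle : ∀ x ∈ Icc (0:ℝ) 1, |w x - u x| ≤ M := by
    intro x hx
    refine le_csSup ⟨ρ, ?_⟩ ⟨x, hx, rfl⟩
    rintro _ ⟨t, ht, rfl⟩
    exact hwu t ht
  have hR : ∀ x ∈ Icc (0:ℝ) 1,
      |f x (u x) - f x (w x) - pderiv1 f x (w x) * (u x - w x)| ≤ thconst f c₀ ρ * M ^ 2 := by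
    intro x hx
    obtain ⟨c, hc, ec⟩ := aux_mvt _ (hD1 x hx) (w x) (u x)
    obtain ⟨d, hd, ed⟩ := aux_mvt _ (hD2 x hx) (w x) c
    have hwx := abs_le.1 (hwu x hx)
    have hux := abs_le.1 (hul x hx)
    have hcw : |c - w x| ≤ |u x - w x| := abs_sub_left_of_mem_uIcc hc
    have hdw : |d - w x| ≤ |c - w x| := abs_sub_left_of_mem_uIcc hd
    have huw : |u x - w x| ≤ M := by rw [abs_sub_comm]; exact hMle x hx
    have hdb : |d| ≤ lconst f c₀ + 2 * ρ := by
      have hd2 : d ∈ uIcc (w x) (u x) :=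
        uIcc_subset_uIcc_left hc hd
      rw [mem_uIcc] at hd2
      rw [abs_le]
      constructor <;> rcases hd2 with h | h <;> linarith [h.1, h.2]
    have hth : |pderiv2 f x d| ≤ thconst f c₀ ρ := hTle x hx d hdb
    have hE : f x (u x) - f x (w x) - pderiv1 f x (w x) * (u x - w x)
        = pderiv2 f x d * (c - w x) * (u x - w x) := by
      change pderiv1 f x c - pderiv1 f x (w x) = pderiv2 f x d * (c - w x) at ed
      change f x (u x) - f x (w x) = pderiv1 f x c * (u x - w x) at ec
      rw [ec, ← ed]; ring
    rw [hE, abs_mul, abs_mul, mul_assoc, sq]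
    have hM0 : 0 ≤ M := (abs_nonneg _).trans huw
    gcongr
    exact hcw.trans huw
  have hK : 0 ≤ c₀ ^ (-2 : ℤ) * (thconst f c₀ ρ * M ^ 2) := by
    rw [hcz]; positivity
  have hsub : ∀ x ∈ Ioo (0:ℝ) 1, iteratedDerivWithin 2 (v - u) (Icc (0:ℝ) 1) x =
      iteratedDerivWithin 2 v (Icc (0:ℝ) 1) x - iteratedDerivWithin 2 u (Icc (0:ℝ) 1) x := by
    intro x hx
    have hxI := Ioo_subset_Icc_self hx
    exact iteratedDerivWithin_sub hxI (uniqueDiffOn_Icc zero_lt_one) (hv x hxI) (huC2 x hxI)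
  have hfin := aux_absmax (v - u) (hv.sub huC2) _ hK (by simp [h0, hu0]) (by simp [h1, hu1])
    (by
      intro x hx hpos hd
      have hxI := Ioo_subset_Icc_self hx
      rw [hsub x hx] at hd
      simp only [Pi.sub_apply] at hpos ⊢
      refine div_bound _ _ ?_
      have a1 := heq x hx
      have a2 := hueq x hx
      have a3 := (abs_le.1 (hR x hxI)).2
      have a4 := mul_le_mul_of_nonneg_right (hfu x hxI (w x)) hpos.le
      have a5 := mul_nonneg hε2.le (sub_nonneg.2 hd)
      linarith)
    (by
      intro x hx hpos hd
      have hxI := Ioo_subset_Icc_self hx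
      rw [hsub x hx] at hd
      simp only [Pi.sub_apply] at hpos ⊢
      refine div_bound _ _ ?_
      have a1 := heq x hx
      have a2 := hueq x hx
      have a3 := (abs_le.1 (hR x hxI)).1
      have a4 := mul_le_mul_of_nonneg_right (hfu x hxI (w x)) (neg_nonneg.2 hpos.le)
      have a5 := mul_nonneg hε2.le hd
      linarith)
  intro x hx
  have := hfin x hx
  rw [mul_assoc]
  exact this
end
end
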